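/- arXiv:2311.05140 — 5 statements merged into one kernel-verified Lean document; each statement's English description precedes it below -/
import Mathlib

section
/- Fix r,D>0 and a nondecreasing function A:(0,∞)→[1,∞). The family of all metric spaces (X,d), where (X,d) is a length space carrying an A-interior-doubling Borel measure such that the r-interior X_r° contains a connected subset W with diam(W,d_W) ≤ D (d_W the induced length metric on W) and such that the closure in X of the r-neighborhood B_r(W,X)={z∈X : d(z,W)<r} equals X, is uniformly totally bounded (with diameters bounded by D+2r), hence precompact in the Gromov–Hausdorff topology. -/
open Set Metric Filter MeasureTheory ENNReal NNReal

noncomputable section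

/-- The infimum of lengths (total variations) of continuous paths from `x` to `y`
with image contained in `S`: the induced length (extended) distance on `S`. -/
def lengthEDistIn {X : Type*} [PseudoEMetricSpace X] (S : Set X) (x y : X) : ℝ≥0∞ :=
  ⨅ (γ : ℝ → X) (_ : ContinuousOn γ (Set.Icc 0 1)) (_ : γ 0 = x) (_ : γ 1 = y)
    (_ : Set.MapsTo γ (Set.Icc 0 1) S), eVariationOn γ (Set.Icc 0 1)

/-- A metric space is a length space if the distance between any two points is the
infimum of lengths of continuous paths joining them. -/
def IsLengthSpace (X : Type*) [MetricSpace X] : Prop :=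
  ∀ x y : X, edist x y = lengthEDistIn (Set.univ : Set X) x y

/-- `(ρ, A₀)`-locally doubling Borel measure. -/
def LocallyDoubling {X : Type*} [MetricSpace X] [MeasurableSpace X]
    (μ : Measure X) (ρ : ℝ) (A₀ : ℝ≥0) : Prop :=
  ∀ (x : X) (r : ℝ), 0 < r → r ≤ ρ →
    0 < μ (Metric.ball x r) ∧
    μ (Metric.ball x r) ≤ (A₀ : ℝ≥0∞) * μ (Metric.ball x (r / 2)) ∧
    (A₀ : ℝ≥0∞) * μ (Metric.ball x (r / 2)) < ⊤

/-- The boundary `∂X = X̄ ∖ X` of a (possibly incomplete) metric space inside its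
metric completion. -/
def completionBoundary (X : Type*) [MetricSpace X] : Set (UniformSpace.Completion X) :=
  {q | q ∉ Set.range ((↑) : X → UniformSpace.Completion X)}

/-- The `r`-interior `X_r° = {x ∈ X : d̄(x, ∂X) > r}` of a (possibly incomplete)
metric space, where distances to the boundary are measured in the completion. -/
def rInterior (X : Type*) [MetricSpace X] (r : ℝ) : Set X :=
  {x : X | ENNReal.ofReal r <
    EMetric.infEdist ((x : X) : UniformSpace.Completion X) (completionBoundary X)}

/-- A Borel measure `μ` on `X` is `A`-interior-doubling: the `A(s)`-doubling condition
holds at every `x` and scale `s` such that the closed `s`-ball around `x` in the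
completion of `X` is contained in `X`. -/
def InteriorDoubling {X : Type*} [MetricSpace X] [MeasurableSpace X]
    (μ : Measure X) (A : ℝ → ℝ≥0) : Prop :=
  ∀ (x : X) (s : ℝ), 0 < s →
    Metric.closedBall ((x : X) : UniformSpace.Completion X) s ⊆
      Set.range ((↑) : X → UniformSpace.Completion X) →
    0 < μ (Metric.ball x s) ∧
    μ (Metric.ball x s) ≤ (A s : ℝ≥0∞) * μ (Metric.ball x (s / 2)) ∧
    (A s : ℝ≥0∞) * μ (Metric.ball x (s / 2)) < ⊤

/-- Points whose closed `η`-ball in the completion stays in `X`. -/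
def goodSet (X : Type) [MetricSpace X] (η : ℝ) : Set X :=
  {x : X | Metric.closedBall ((x : X) : UniformSpace.Completion X) η ⊆
      Set.range ((↑) : X → UniformSpace.Completion X)}

/-- Points reachable from `p` by `k` steps of size at most `δ` in `S`. -/
def reach {X : Type} [MetricSpace X] (S : Set X) (δ : ℝ) (p : X) : ℕ → Set X
  | 0 => {p}
  | (k + 1) => {y | y ∈ S ∧ ∃ x ∈ reach S δ p k, dist x y ≤ δ}

lemma reach_succ_of_mem {X : Type} [MetricSpace X] {S : Set X} {δ : ℝ} (hδ : 0 < δ) {p y : X}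
    {k : ℕ} (hy : y ∈ S) (h : y ∈ reach S δ p k) : ∀ m, y ∈ reach S δ p (k + m) := by
  intro m
  induction m with
  | zero => exact h
  | succ m ih => exact ⟨hy, y, ih, by simp [hδ.le]⟩

lemma reach_path {X : Type} [MetricSpace X] {S : Set X} {δ : ℝ} (hδ : 0 < δ) {p : X}
    (γ : ℝ → X) (b : ℝ) : ∀ (n : ℕ) (a : ℝ) (k : ℕ), a ≤ b → ContinuousOn γ (Icc a b) →
    MapsTo γ (Icc a b) S → eVariationOn γ (Icc a b) ≤ ENNReal.ofReal (n * δ) →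
    γ a ∈ reach S δ p k → γ b ∈ reach S δ p (k + n) := by
  intro n
  induction n with
  | zero =>
    intro a k hab _ _ hv ha
    have h1 := eVariationOn.edist_le γ (left_mem_Icc.2 hab) (right_mem_Icc.2 hab)
    have h2 : edist (γ a) (γ b) ≤ 0 := h1.trans (by simpa using hv)
    have h3 : γ a = γ b := edist_le_zero.1 h2
    rw [← h3]; exact ha
  | succ n ih =>
    intro a k hab hc hm hv ha
    by_cases hd : dist (γ a) (γ b) ≤ δ
    · have hb : γ b ∈ S := hm (right_mem_Icc.2 hab)
      have h1 : γ b ∈ reach S δ p (k + 1) := ⟨hb, γ a, ha, hd⟩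
      have := reach_succ_of_mem hδ hb h1 n
      rwa [show k + (n + 1) = k + 1 + n by omega]
    · push Not at hd
      have hcd : ContinuousOn (fun t => dist (γ a) (γ t)) (Icc a b) :=
        by fun_prop
      obtain ⟨c, hcI, hcδ⟩ := intermediate_value_Icc hab hcd
        (show δ ∈ Icc (dist (γ a) (γ a)) (dist (γ a) (γ b)) from ⟨by simp [hδ.le], hd.le⟩)
      have hsplit := eVariationOn.Icc_add_Icc γ (s := univ) hcI.1 hcI.2 (mem_univ c)
      simp only [univ_inter] at hsplit
      have hac : ENNReal.ofReal δ ≤ eVariationOn γ (Icc a c) := by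
        have h1 := eVariationOn.edist_le γ (left_mem_Icc.2 hcI.1) (right_mem_Icc.2 hcI.1)
        rwa [edist_dist, show dist (γ a) (γ c) = δ from hcδ] at h1
      have hv' : eVariationOn γ (Icc c b) ≤ ENNReal.ofReal (n * δ) := by
        have e : ENNReal.ofReal ((n + 1 : ℕ) * δ) = ENNReal.ofReal δ + ENNReal.ofReal (n * δ) := by
          rw [← ENNReal.ofReal_add hδ.le (by positivity)]; push_cast; ring_nf
        rw [e, ← hsplit] at hv
        have : ENNReal.ofReal δ + eVariationOn γ (Icc c b)
            ≤ ENNReal.ofReal δ + ENNReal.ofReal (n * δ) :=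
          le_trans (add_le_add hac le_rfl) hv
        exact (ENNReal.add_le_add_iff_left ENNReal.ofReal_ne_top).1 this
      have hsub : Icc c b ⊆ Icc a b := Icc_subset_Icc_left hcI.1
      have h1 : γ c ∈ reach S δ p (k + 1) := ⟨hm hcI, γ a, ha, hcδ.le⟩
      have := ih c (k + 1) hcI.2 (hc.mono hsub) (hm.mono_left hsub) hv' h1
      rwa [show k + (n + 1) = k + 1 + n by omega]

lemma exists_path {X : Type} [MetricSpace X] {S : Set X} {x y : X} {L : ℝ≥0∞}
    (h : lengthEDistIn S x y < L) : ∃ γ : ℝ → X, ContinuousOn γ (Icc 0 1) ∧ γ 0 = x ∧ γ 1 = y ∧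
      MapsTo γ (Icc 0 1) S ∧ eVariationOn γ (Icc 0 1) < L := by
  simp only [lengthEDistIn, iInf_lt_iff] at h
  obtain ⟨γ, h1, h2, h3, h4, h5⟩ := h
  exact ⟨γ, h1, h2, h3, h4, h5⟩

lemma edist_le_length {X : Type} [MetricSpace X] {S : Set X} {x y : X} :
    edist x y ≤ lengthEDistIn S x y := by
  simp only [lengthEDistIn, le_iInf_iff]
  rintro γ _ rfl rfl _
  exact eVariationOn.edist_le γ (by simp) (by simp)

lemma measure_bound {X : Type} [MetricSpace X] [MeasurableSpace X]
    {μ : Measure X} {A : ℝ → ℝ≥0} (hA_mono : ∀ a b : ℝ, 0 < a → a ≤ b → A a ≤ A b)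
    (hμ : InteriorDoubling μ A) {η : ℝ} (hη : 0 < η) {t : X} (ht : t ∈ goodSet X η) :
    ∀ j : ℕ, μ (ball t η) ≤ (A η : ℝ≥0∞) ^ j * μ (ball t (η / 2 ^ j)) := by
  intro j
  induction j with
  | zero => simp
  | succ j ih =>
    have hs : 0 < η / 2 ^ j := by positivity
    have hle : η / 2 ^ j ≤ η := div_le_self hη.le (one_le_pow₀ (by norm_num))
    have h1 := (hμ t (η / 2 ^ j) hs ((closedBall_subset_closedBall hle).trans ht)).2.1
    calc _ ≤ _ := ih
      _ ≤ (A η : ℝ≥0∞) ^ j * ((A η : ℝ≥0∞) * μ (ball t (η / 2 ^ j / 2))) := by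
          gcongr
          refine h1.trans ?_
          gcongr
          exact hA_mono _ _ hs hle
      _ = _ := by rw [pow_succ, pow_succ, mul_assoc, div_div]

lemma packing {X : Type} [MetricSpace X] [MeasurableSpace X] [BorelSpace X]
    {μ : Measure X} {A : ℝ → ℝ≥0} (hA_mono : ∀ a b : ℝ, 0 < a → a ≤ b → A a ≤ A b)
    (hA_one : ∀ a : ℝ, 0 < a → 1 ≤ A a)
    (hμ : InteriorDoubling μ A) {η : ℝ} (hη : 0 < η) {x : X} (hx : x ∈ goodSet X η)
    (T : Finset X) (hT : ∀ t ∈ T, t ∈ goodSet X η ∧ dist t x < η / 4)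
    (hsep : ∀ s ∈ T, ∀ t ∈ T, s ≠ t → η / 8 ≤ dist s t) :
    T.card ≤ ⌈(A η) ^ 4⌉₊ := by
  have hfin : μ (ball x (η / 2)) ≠ ⊤ := by
    have h := (hμ x η hη hx).2.2
    have h1 : (1 : ℝ≥0∞) ≤ A η := by exact_mod_cast hA_one η hη
    refine (lt_of_le_of_lt ?_ h).ne
    calc μ (ball x (η / 2)) = 1 * μ (ball x (η / 2)) := (one_mul _).symm
      _ ≤ _ := by gcongr
  have hpos : μ (ball x (η / 2)) ≠ 0 :=
    (hμ x (η / 2) (by positivity)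
      ((closedBall_subset_closedBall (by linarith)).trans hx)).1.ne'
  have hdisj : (T : Set X).PairwiseDisjoint (fun t => ball t (η / 2 ^ 4)) := by
    intro s hs t ht hst
    apply ball_disjoint_ball
    have := hsep s hs t ht hst
    linarith
  have key : (T.card : ℝ≥0∞) * μ (ball x (η / 2)) ≤ (A η : ℝ≥0∞) ^ 4 * μ (ball x (η / 2)) := by
    calc (T.card : ℝ≥0∞) * μ (ball x (η / 2)) = ∑ t ∈ T, μ (ball x (η / 2)) := by simp
      _ ≤ ∑ t ∈ T, (A η : ℝ≥0∞) ^ 4 * μ (ball t (η / 2 ^ 4)) := by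
          refine Finset.sum_le_sum fun t ht => ?_
          refine le_trans (measure_mono ?_) (measure_bound hA_mono hμ hη (hT t ht).1 4)
          apply ball_subset_ball'
          have := (hT t ht).2
          rw [dist_comm] at this
          linarith
      _ = (A η : ℝ≥0∞) ^ 4 * ∑ t ∈ T, μ (ball t (η / 2 ^ 4)) := by rw [Finset.mul_sum]
      _ = (A η : ℝ≥0∞) ^ 4 * μ (⋃ t ∈ T, ball t (η / 2 ^ 4)) := by
          rw [measure_biUnion_finset hdisj (fun t _ => measurableSet_ball)]
      _ ≤ _ := by
          gcongr
          refine iUnion₂_subset fun t ht => ?_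
          apply ball_subset_ball'
          have := (hT t ht).2
          linarith
  have h2 : (T.card : ℝ≥0∞) ≤ (A η : ℝ≥0∞) ^ 4 :=
    (ENNReal.mul_le_mul_iff_left hpos hfin).1 key
  have h3 : (T.card : ℝ≥0) ≤ (A η) ^ 4 := by exact_mod_cast h2
  exact_mod_cast h3.trans (Nat.le_ceil _)

lemma local_cover {X : Type} [MetricSpace X] {P : Set X} {ρ : ℝ} (hρ : 0 ≤ ρ) (K : ℕ)
    (h : ∀ T : Finset X, (∀ t ∈ T, t ∈ P) → (∀ s ∈ T, ∀ t ∈ T, s ≠ t → ρ ≤ dist s t) →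
      T.card ≤ K) :
    ∃ T : Finset X, (∀ t ∈ T, t ∈ P) ∧ T.card ≤ K ∧ ∀ x ∈ P, ∃ t ∈ T, dist x t ≤ ρ := by
  classical
  by_contra hcon
  have : ∀ n : ℕ, ∃ T : Finset X, (∀ t ∈ T, t ∈ P) ∧
      (∀ s ∈ T, ∀ t ∈ T, s ≠ t → ρ ≤ dist s t) ∧ T.card = n := by
    intro n
    induction n with
    | zero => exact ⟨∅, by simp, by simp, rfl⟩
    | succ n ih =>
      obtain ⟨T, h1, h2, h3⟩ := ih
      have : ∃ x ∈ P, ∀ t ∈ T, x ≠ t ∧ ρ < dist x t := by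
        by_contra hno
        push Not at hno
        apply hcon
        refine ⟨T, h1, h T h1 h2, fun x hx => ?_⟩
        obtain ⟨t, ht, hxt⟩ := hno x hx
        refine ⟨t, ht, ?_⟩
        by_cases e : x = t
        · simpa [e] using hρ
        · exact hxt e
      obtain ⟨x, hx, hxT⟩ := this
      refine ⟨insert x T, ?_, ?_, ?_⟩
      · intro t ht
        rcases Finset.mem_insert.1 ht with rfl | ht
        · exact hx
        · exact h1 t ht
      · intro s hs t ht hst
        rcases Finset.mem_insert.1 hs with rfl | hs' <;>
          rcases Finset.mem_insert.1 ht with rfl | ht'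
        · exact absurd rfl hst
        · exact (hxT t ht').2.le
        · rw [dist_comm]; exact (hxT s hs').2.le
        · exact h2 s hs' t ht' hst
      · rw [Finset.card_insert_of_notMem, h3]
        intro hxm
        exact (hxT x hxm).1 rfl
  obtain ⟨T, h1, h2, h3⟩ := this (K + 1)
  have := h T h1 h2
  omega

lemma reach_cover {X : Type} [MetricSpace X] [MeasurableSpace X] [BorelSpace X]
    {μ : Measure X} {A : ℝ → ℝ≥0} (hA_mono : ∀ a b : ℝ, 0 < a → a ≤ b → A a ≤ A b)
    (hA_one : ∀ a : ℝ, 0 < a → 1 ≤ A a)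
    (hμ : InteriorDoubling μ A) {η : ℝ} (hη : 0 < η) {p : X} (hp : p ∈ goodSet X η) (k : ℕ) :
    ∃ F : Finset X, (∀ t ∈ F, t ∈ goodSet X η) ∧ F.card ≤ ⌈(A η) ^ 4⌉₊ ^ k ∧
      ∀ x ∈ reach (goodSet X η) (η / 16) p k, ∃ t ∈ F, dist x t ≤ η / 8 := by
  classical
  induction k with
  | zero =>
    refine ⟨{p}, by simpa using hp, by simp, ?_⟩
    intro x hx
    have : x = p := hx
    exact ⟨p, by simp, by simp [this]; positivity⟩
  | succ k ih =>
    obtain ⟨F, h1, h2, h3⟩ := ih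
    have hl : ∀ y : X, ∃ T : Finset X, y ∈ F → (∀ t ∈ T, t ∈ goodSet X η ∧ dist t y < η / 4) ∧
        T.card ≤ ⌈(A η) ^ 4⌉₊ ∧
        ∀ x, x ∈ goodSet X η ∧ dist x y < η / 4 → ∃ t ∈ T, dist x t ≤ η / 8 := by
      intro y
      by_cases hy : y ∈ F
      · obtain ⟨T, a, b, c⟩ := local_cover (P := {x | x ∈ goodSet X η ∧ dist x y < η / 4})
          (ρ := η / 8) (by positivity) ⌈(A η) ^ 4⌉₊
          (fun T hT hs => packing hA_mono hA_one hμ hη (h1 y hy) T hT hs)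
        exact ⟨T, fun _ => ⟨a, b, c⟩⟩
      · exact ⟨∅, fun h => absurd h hy⟩
    choose T hT using hl
    refine ⟨F.biUnion T, ?_, ?_, ?_⟩
    · intro t ht
      obtain ⟨y, hy, hty⟩ := Finset.mem_biUnion.1 ht
      exact ((hT y hy).1 t hty).1
    · calc _ ≤ F.card * ⌈(A η) ^ 4⌉₊ :=
            Finset.card_biUnion_le_card_mul _ _ _ (fun y hy => (hT y hy).2.1)
        _ ≤ _ := (Nat.mul_le_mul_right _ h2).trans_eq (pow_succ _ _).symm
    · rintro x ⟨hx, z, hz, hzx⟩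
      obtain ⟨y, hy, hzy⟩ := h3 z hz
      have hxy : dist x y < η / 4 := by
        have := dist_triangle x z y
        rw [dist_comm x z] at this
        linarith
      obtain ⟨t, ht, hxt⟩ := (hT y hy).2.2 x ⟨hx, hxy⟩
      exact ⟨t, Finset.mem_biUnion.2 ⟨y, hy, ht⟩, hxt⟩

lemma rInterior_good {X : Type} [MetricSpace X] {r : ℝ} {w : X} (hw : w ∈ rInterior X r) :
    w ∈ goodSet X r := by
  intro q hq
  by_contra hn
  have h1 : ENNReal.ofReal r < _ := hw
  have h2 := h1.trans_le (Metric.infEDist_le_edist_of_mem (show q ∈ completionBoundary X from hn))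
  rw [mem_closedBall, dist_comm] at hq
  rw [edist_dist] at h2
  exact absurd (ENNReal.ofReal_le_ofReal hq) (not_le.2 h2)

lemma good_shift {X : Type} [MetricSpace X] {r η : ℝ} {w x : X} (hw : w ∈ goodSet X r)
    (h : dist w x ≤ r - η) : x ∈ goodSet X η := by
  refine Set.Subset.trans ?_ hw
  apply closedBall_subset_closedBall'
  rw [UniformSpace.Completion.dist_eq, dist_comm]
  linarith

/-- The paper's Theorem on manifolds with boundary, case (2) (metric-measure form): the
family of length spaces with an `A`-interior-doubling measure, whose `r`-interior
contains a connected subset `W` of intrinsic diameter `≤ D` whose closed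
`r`-neighborhood is the whole space, is uniformly totally bounded (with diameters
bounded by `D + 2r`), hence precompact in the Gromov–Hausdorff topology. -/
theorem thick_core_uniformly_totallyBounded (r D : ℝ) (hr : 0 < r) (hD : 0 < D)
    (A : ℝ → ℝ≥0) (hA_mono : ∀ a b : ℝ, 0 < a → a ≤ b → A a ≤ A b)
    (hA_one : ∀ a : ℝ, 0 < a → 1 ≤ A a) :
    ∃ N : ℝ → ℕ,
      ∀ (X : Type) [MetricSpace X] [MeasurableSpace X] [BorelSpace X]
        (μ : Measure X) (W : Set X),
        IsLengthSpace X → InteriorDoubling μ A →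
        IsConnected W → W ⊆ rInterior X r →
        (∀ x ∈ W, ∀ y ∈ W, lengthEDistIn W x y ≤ ENNReal.ofReal D) →
        closure {z : X | ∃ w ∈ W, dist z w < r} = Set.univ →
        (∀ x y : X, dist x y ≤ D + 2 * r) ∧
        ∀ ε : ℝ, 0 < ε →
          ∃ F : Finset X, F.card ≤ N ε ∧ ∀ x : X, ∃ y ∈ F, dist x y < ε := by
  classical
  refine ⟨fun ε => ⌈(A (min (ε / 2) r)) ^ 4⌉₊ ^
    (⌈(D + 1) / (min (ε / 2) r / 16)⌉₊ + ⌈r / (min (ε / 2) r / 16)⌉₊), ?_⟩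
  intro X _ _ _ μ W hlen hμ hW hWr hWD hcl
  have happ : ∀ x : X, ∀ e : ℝ, 0 < e → ∃ z, dist x z < e ∧ ∃ w ∈ W, dist z w < r := by
    intro x e he
    have hx : x ∈ closure {z : X | ∃ w ∈ W, dist z w < r} := by rw [hcl]; trivial
    obtain ⟨z, hz, hxz⟩ := Metric.mem_closure_iff.1 hx e he
    exact ⟨z, hxz, hz⟩
  constructor
  · intro x y
    refine le_of_forall_pos_le_add fun e he => ?_
    obtain ⟨z, hxz, w, hw, hzw⟩ := happ x (e / 2) (by positivity)
    obtain ⟨z', hyz, w', hw', hzw'⟩ := happ y (e / 2) (by positivity)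
    have h1 : dist w w' ≤ D := by
      have := edist_le_length.trans (hWD w hw w' hw')
      rw [edist_dist] at this
      exact (ENNReal.ofReal_le_ofReal_iff hD.le).1 this
    have h2 := dist_triangle4 x z w w'
    have h3 := dist_triangle4 x w' z' y
    rw [dist_comm w' z', dist_comm z' y] at h3
    linarith
  · intro ε hε
    set η := min (ε / 2) r with hηdef
    have hη : 0 < η := lt_min (by positivity) hr
    have hηr : η ≤ r := min_le_right _ _
    have hηε : η ≤ ε / 2 := min_le_left _ _
    have hδ : 0 < η / 16 := by positivity
    have hWgood : W ⊆ goodSet X η := fun w hw =>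
      good_shift (rInterior_good (hWr hw)) (by simp [hηr])
    obtain ⟨p, hp⟩ := hW.nonempty
    set n1 := ⌈(D + 1) / (η / 16)⌉₊
    set n2 := ⌈r / (η / 16)⌉₊
    have hn1 : D + 1 ≤ n1 * (η / 16) := (div_le_iff₀ hδ).1 (Nat.le_ceil _)
    have hn2 : r ≤ n2 * (η / 16) := (div_le_iff₀ hδ).1 (Nat.le_ceil _)
    obtain ⟨F, hF1, hF2, hF3⟩ := reach_cover hA_mono hA_one hμ hη (hWgood hp) (n1 + n2)
    refine ⟨F, hF2, fun x => ?_⟩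
    have hreachW : ∀ w ∈ W, w ∈ reach (goodSet X η) (η / 16) p n1 := by
      intro w hw
      have hlt : lengthEDistIn W p w < ENNReal.ofReal (D + 1) :=
        (hWD p hp w hw).trans_lt ((ENNReal.ofReal_lt_ofReal_iff (by linarith)).2 (by linarith))
      obtain ⟨γ, hc, h0, h1, hm, hv⟩ := exists_path hlt
      have := reach_path (S := goodSet X η) hδ (p := p) γ 1 n1 0 0 zero_le_one hc
        (hm.mono_right hWgood) (hv.le.trans (ENNReal.ofReal_le_ofReal hn1)) h0
      rwa [h1, zero_add] at this
    obtain ⟨z, hxz, w, hw, hzw⟩ := happ x (ε / 4) (by positivity)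
    have hmain : ∃ x' ∈ reach (goodSet X η) (η / 16) p (n1 + n2), dist z x' ≤ η := by
      by_cases hd : dist z w ≤ η
      · exact ⟨w, reach_succ_of_mem hδ (hWgood hw) (hreachW w hw) n2, hd⟩
      · push Not at hd
        have hlt : lengthEDistIn univ w z < ENNReal.ofReal r := by
          rw [← hlen w z, edist_comm, edist_dist]
          exact (ENNReal.ofReal_lt_ofReal_iff hr).2 hzw
        obtain ⟨γ, hc, h0, h1, -, hv⟩ := exists_path hlt
        have hcd : ContinuousOn (fun t => dist z (γ t)) (Icc 0 1) := by fun_prop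
        obtain ⟨c, hcI, hcη⟩ := intermediate_value_Icc' zero_le_one hcd
          (show η ∈ Icc (dist z (γ 1)) (dist z (γ 0)) from
            ⟨by simp [h1, hη.le], by rw [h0]; exact hd.le⟩)
        have hcη : dist z (γ c) = η := hcη
        have hsplit := eVariationOn.Icc_add_Icc γ (s := univ) hcI.1 hcI.2 (mem_univ c)
        simp only [univ_inter] at hsplit
        have hcb : ENNReal.ofReal η ≤ eVariationOn γ (Icc c 1) := by
          have h2 := eVariationOn.edist_le γ (right_mem_Icc.2 hcI.2) (left_mem_Icc.2 hcI.2)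
          rwa [h1, edist_dist, hcη] at h2
        have hvar : eVariationOn γ (Icc 0 c) ≤ ENNReal.ofReal (r - η) := by
          have e : ENNReal.ofReal r = ENNReal.ofReal (r - η) + ENNReal.ofReal η := by
            rw [← ENNReal.ofReal_add (by linarith) hη.le]; ring_nf
          rw [e, ← hsplit] at hv
          exact (ENNReal.add_le_add_iff_right ENNReal.ofReal_ne_top).1
            ((add_le_add le_rfl hcb).trans hv.le)
        have hm : MapsTo γ (Icc 0 c) (goodSet X η) := by
          intro t ht
          apply good_shift (rInterior_good (hWr hw))
          have h2 := (eVariationOn.edist_le γ (left_mem_Icc.2 hcI.1) ht).trans hvar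
          rw [h0, edist_dist] at h2
          exact (ENNReal.ofReal_le_ofReal_iff (by linarith)).1 h2
        refine ⟨γ c, ?_, hcη.le⟩
        refine reach_path hδ γ c n2 0 n1 hcI.1 (hc.mono (Icc_subset_Icc_right hcI.2)) hm
          (hvar.trans (ENNReal.ofReal_le_ofReal (by linarith))) ?_
        rw [h0]; exact hreachW w hw
    obtain ⟨x', hx', hzx'⟩ := hmain
    obtain ⟨y, hy, hxy⟩ := hF3 x' hx'
    refine ⟨y, hy, ?_⟩
    have := dist_triangle4 x z x' y
    linarith
end
end

section
/- Fix D>0, a sequence of positive numbers r_i→0, and a nondecreasing function A:(0,∞)→[1,∞). Let ℳ be a family of length spaces (X,d), each carrying an A-interior-doubling Borel measure, such that for every i the r_i-interior satisfies diam(X_{r_i}°, d_{X_{r_i}°}) ≤ D (in particular X_{r_i}° is either connected or empty), and such that the family of boundaries {(∂X, d̄|_{∂X})}, each equipped with the metric restricted from the completion, is uniformly totally bounded. Then ℳ is uniformly totally bounded, hence precompact in the Gromov–Hausdorff topology. -/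
open Set Metric Filter MeasureTheory ENNReal NNReal

noncomputable section

theorem closedBall_sub_range {X : Type*} [MetricSpace X] {r s : ℝ} {x : X}
    (hx : x ∈ rInterior X r) (hs : s ≤ r) :
    Metric.closedBall ((x : X) : UniformSpace.Completion X) s ⊆
      Set.range ((↑) : X → UniformSpace.Completion X) := by
  intro z hz
  by_contra hzn
  have h1 : Metric.infEDist ((x : X) : UniformSpace.Completion X) (completionBoundary X)
      ≤ edist ((x : X) : UniformSpace.Completion X) z := Metric.infEDist_le_edist_of_mem hzn
  have h2 : edist ((x : X) : UniformSpace.Completion X) z ≤ ENNReal.ofReal r := by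
    rw [edist_dist, dist_comm]
    exact ENNReal.ofReal_le_ofReal (le_trans hz hs)
  have h3 : ENNReal.ofReal r <
    Metric.infEDist ((x : X) : UniformSpace.Completion X) (completionBoundary X) := hx
  exact absurd (h1.trans h2) (not_le.2 h3)

theorem doubling_step {X : Type*} [MetricSpace X] [MeasurableSpace X] {μ : Measure X}
    {A : ℝ → ℝ≥0} (hA_mono : ∀ a b : ℝ, 0 < a → a ≤ b → A a ≤ A b)
    (hμ : InteriorDoubling μ A) {r s : ℝ} (hs : 0 < s) (hsr : s ≤ r) {x : X}
    (hx : x ∈ rInterior X r) :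
    μ (Metric.ball x s) ≤ (A r : ℝ≥0∞) * μ (Metric.ball x (s / 2)) := by
  refine (hμ x s hs (closedBall_sub_range hx hsr)).2.1.trans ?_
  gcongr
  exact hA_mono s r hs hsr

theorem card_sep_le {X : Type*} [MetricSpace X] [MeasurableSpace X] [BorelSpace X]
    {μ : Measure X}
    {A : ℝ → ℝ≥0} (hA_mono : ∀ a b : ℝ, 0 < a → a ≤ b → A a ≤ A b)
    (hμ : InteriorDoubling μ A) {r s : ℝ} (hs : 0 < s) (hsr : 4 * s ≤ r) {p : X}
    (hp : p ∈ rInterior X r) (Q : Finset X) (hQ : ∀ q ∈ Q, q ∈ rInterior X r ∧ dist q p < s)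
    (hsep : ∀ q ∈ Q, ∀ q' ∈ Q, q ≠ q' → s / 2 ≤ dist q q') :
    Q.card ≤ ⌈(A r) ^ 4⌉₊ := by
  set m := μ (Metric.ball p (5 / 4 * s)) with hm
  have hd := hμ p (5 / 4 * s) (by positivity) (closedBall_sub_range hp (by linarith))
  have hm0 : m ≠ 0 := hd.1.ne'
  have hmt : m ≠ ⊤ := (hd.2.1.trans_lt hd.2.2).ne
  have h1 : ∀ q ∈ Q, m ≤ ((A r) ^ 4 : ℝ≥0) * μ (Metric.ball q (s / 4)) := by
    intro q hq
    obtain ⟨hqr, hqp⟩ := hQ q hq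
    have e1 := doubling_step hA_mono hμ (s := 4 * s) (by positivity) hsr hqr
    have e2 := doubling_step hA_mono hμ (s := 4 * s / 2) (by positivity) (by linarith) hqr
    have e3 := doubling_step hA_mono hμ (s := 4 * s / 2 / 2) (by positivity) (by linarith) hqr
    have e4 := doubling_step hA_mono hμ (s := 4 * s / 2 / 2 / 2) (by positivity) (by linarith) hqr
    have e5 : 4 * s / 2 / 2 / 2 / 2 = s / 4 := by ring
    rw [e5] at e4
    calc m ≤ μ (Metric.ball q (4 * s)) := by
          apply measure_mono
          apply Metric.ball_subset_ball'
          rw [dist_comm]; linarith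
      _ ≤ A r * (A r * (A r * (A r * μ (Metric.ball q (s / 4))))) := by
          refine e1.trans ?_
          gcongr
          refine e2.trans ?_
          gcongr
          refine e3.trans ?_
          gcongr
      _ = _ := by push_cast; ring
  have h2 : ∑ q ∈ Q, μ (Metric.ball q (s / 4)) ≤ m := by
    rw [← measure_biUnion_finset]
    · apply measure_mono
      refine Set.iUnion₂_subset fun q hq => ?_
      apply Metric.ball_subset_ball'
      have := (hQ q hq).2
      linarith
    · intro q hq q' hq' hne
      apply Metric.ball_disjoint_ball
      have := hsep q hq q' hq' hne
      linarith
    · intro q _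
      exact Metric.isOpen_ball.measurableSet
  have h3 : (Q.card : ℝ≥0∞) * m ≤ ((A r) ^ 4 : ℝ≥0) * m := by
    calc (Q.card : ℝ≥0∞) * m = ∑ q ∈ Q, m := by simp
      _ ≤ ∑ q ∈ Q, ((A r) ^ 4 : ℝ≥0) * μ (Metric.ball q (s / 4)) := Finset.sum_le_sum h1
      _ = ((A r) ^ 4 : ℝ≥0) * ∑ q ∈ Q, μ (Metric.ball q (s / 4)) := by rw [Finset.mul_sum]
      _ ≤ _ := by gcongr
  have h4 : (Q.card : ℝ≥0∞) ≤ ((A r) ^ 4 : ℝ≥0) := (ENNReal.mul_le_mul_iff_left hm0 hmt).1 h3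
  have h5 : (Q.card : ℝ≥0) ≤ (A r) ^ 4 := by exact_mod_cast h4
  exact_mod_cast h5.trans (Nat.le_ceil _)

theorem local_cover_s11 {X : Type*} [MetricSpace X] {S : Set X} {p : X} {s : ℝ} {K : ℕ} (hs : 0 < s)
    (h : ∀ Q : Finset X, (∀ q ∈ Q, q ∈ S ∧ dist q p < s) →
      (∀ q ∈ Q, ∀ q' ∈ Q, q ≠ q' → s / 2 ≤ dist q q') → Q.card ≤ K) :
    ∃ Q : Finset X, (∀ q ∈ Q, q ∈ S) ∧ Q.card ≤ K ∧
      ∀ z ∈ S, dist z p < s → ∃ q ∈ Q, dist z q < s / 2 := by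
  classical
  let P : ℕ → Prop := fun n => ∃ Q : Finset X, Q.card = n ∧ (∀ q ∈ Q, q ∈ S ∧ dist q p < s) ∧
      (∀ q ∈ Q, ∀ q' ∈ Q, q ≠ q' → s / 2 ≤ dist q q')
  have hP0 : P 0 := ⟨∅, by simp⟩
  obtain ⟨Q, hc, hQ, hsep⟩ : P (Nat.findGreatest P K) := Nat.findGreatest_spec (Nat.zero_le K) hP0
  refine ⟨Q, fun q hq => (hQ q hq).1, h Q hQ hsep, ?_⟩
  intro z hz hzp
  by_contra! hcon
  have hzQ : z ∉ Q := fun hzQ => by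
    have := hcon z hzQ
    simp at this
    linarith
  have hQ' : ∀ q ∈ insert z Q, q ∈ S ∧ dist q p < s := by
    intro q hq
    rcases Finset.mem_insert.1 hq with rfl | hq
    · exact ⟨hz, hzp⟩
    · exact hQ q hq
  have hsep' : ∀ q ∈ insert z Q, ∀ q' ∈ insert z Q, q ≠ q' → s / 2 ≤ dist q q' := by
    intro q hq q' hq' hne
    rcases Finset.mem_insert.1 hq with rfl | hqq <;>
      rcases Finset.mem_insert.1 hq' with rfl | hqq'
    · exact absurd rfl hne
    · exact hcon _ hqq'
    · rw [dist_comm]; exact hcon _ hqq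
    · exact hsep _ hqq _ hqq' hne
  have hcard := Finset.card_insert_of_notMem hzQ
  have hle : Q.card + 1 ≤ Nat.findGreatest P K :=
    Nat.le_findGreatest (by rw [← hcard]; exact h _ hQ' hsep') ⟨_, hcard, hQ', hsep'⟩
  omega

/-- Chains of `k` steps of size at most `η` inside `S`. -/
def ChainReach {X : Type*} [MetricSpace X] (S : Set X) (η : ℝ) : ℕ → X → X → Prop
  | 0, x, y => x = y
  | k + 1, x, y => ∃ z ∈ S, dist x z ≤ η ∧ ChainReach S η k z y

theorem chainReach_refl {X : Type*} [MetricSpace X] {S : Set X} {η : ℝ} (hη : 0 ≤ η) {x : X}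
    (hx : x ∈ S) (k : ℕ) : ChainReach S η k x x := by
  induction k with
  | zero => exact rfl
  | succ k ih => exact ⟨x, hx, by simpa using hη, ih⟩

theorem chainReach_path {X : Type*} [MetricSpace X] {S : Set X} {η : ℝ} (hη : 0 ≤ η)
    {γ : ℝ → X} (hc : ContinuousOn γ (Set.Icc 0 1)) (hS : Set.MapsTo γ (Set.Icc 0 1) S) (k : ℕ) :
    ∀ t ∈ Set.Icc (0 : ℝ) 1, eVariationOn γ (Set.Icc t 1) ≤ k * ENNReal.ofReal η →
      ChainReach S η k (γ t) (γ 1) := by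
  induction k with
  | zero =>
    intro t ht hv
    have h := eVariationOn.edist_le γ (s := Set.Icc t 1) (x := t) (y := 1)
      ⟨le_rfl, ht.2⟩ ⟨ht.2, le_rfl⟩
    have h0 : edist (γ t) (γ 1) ≤ 0 := h.trans (by simpa using hv)
    exact edist_le_zero.1 h0
  | succ k ih =>
    intro t ht hv
    have h1S : γ 1 ∈ S := hS ⟨zero_le_one, le_rfl⟩
    by_cases h1 : dist (γ t) (γ 1) ≤ η
    · exact ⟨γ 1, h1S, h1, chainReach_refl hη h1S k⟩
    push Not at h1
    have hg : ContinuousOn (fun u => dist (γ t) (γ u)) (Set.Icc t 1) :=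
      (continuous_const.dist continuous_id).comp_continuousOn (hc.mono (Set.Icc_subset_Icc_left ht.1))
    obtain ⟨u, hu, hgu⟩ := intermediate_value_Icc ht.2 hg (show η ∈ _ from ⟨by simpa using hη, h1.le⟩)
    have hu01 : u ∈ Set.Icc (0 : ℝ) 1 := ⟨ht.1.trans hu.1, hu.2⟩
    refine ⟨γ u, hS hu01, hgu.le, ih u hu01 ?_⟩
    have hadd := eVariationOn.Icc_add_Icc γ (s := Set.univ) hu.1 hu.2 (Set.mem_univ u)
    simp only [Set.univ_inter] at hadd
    have hge : ENNReal.ofReal η ≤ eVariationOn γ (Set.Icc t u) := by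
      have h := eVariationOn.edist_le γ (s := Set.Icc t u) (x := t) (y := u)
        ⟨le_rfl, hu.1⟩ ⟨hu.1, le_rfl⟩
      rw [edist_dist] at h
      simp only at hgu
      rwa [hgu] at h
    have : ENNReal.ofReal η + eVariationOn γ (Set.Icc u 1)
        ≤ ENNReal.ofReal η + k * ENNReal.ofReal η := by
      calc _ ≤ eVariationOn γ (Set.Icc t u) + eVariationOn γ (Set.Icc u 1) := by gcongr
        _ ≤ _ := by rw [hadd]; refine hv.trans (le_of_eq ?_); push_cast; ring
    exact (ENNReal.add_le_add_iff_left ENNReal.ofReal_ne_top).1 this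

theorem chain_cover {X : Type*} [MetricSpace X] {S : Set X} {s : ℝ} {K : ℕ}
    (hloc : ∀ p ∈ S, ∃ Q : Finset X, (∀ q ∈ Q, q ∈ S) ∧ Q.card ≤ K ∧
      ∀ z ∈ S, dist z p < s → ∃ q ∈ Q, dist z q < s / 2) (k : ℕ) :
    ∀ P : Finset X, (∀ p ∈ P, p ∈ S) → ∃ Q : Finset X, Q.card ≤ P.card * K ^ k ∧
      ∀ x y, (∃ p ∈ P, dist x p < s / 2) → ChainReach S (s / 2) k x y →
        ∃ q ∈ Q, dist y q < s / 2 := by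
  classical
  induction k with
  | zero =>
    intro P hP
    refine ⟨P, by simp, ?_⟩
    rintro x y hx (rfl : x = y)
    exact hx
  | succ k ih =>
    intro P hP
    choose! f hfS hfK hf using hloc
    obtain ⟨Q, hQc, hQ⟩ := ih (P.biUnion f) (by
      intro p hp
      obtain ⟨a, ha, hpa⟩ := Finset.mem_biUnion.1 hp
      exact hfS a (hP a ha) p hpa)
    refine ⟨Q, ?_, ?_⟩
    · have h1 : (P.biUnion f).card ≤ P.card * K :=
        Finset.card_biUnion_le_card_mul _ _ _ fun p hp => hfK p (hP p hp)
      calc Q.card ≤ (P.biUnion f).card * K ^ k := hQc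
        _ ≤ P.card * K * K ^ k := by gcongr
        _ = _ := by ring
    · rintro x y ⟨p, hp, hxp⟩ ⟨z, hz, hxz, hzy⟩
      refine hQ z y ?_ hzy
      have hzp : dist z p < s := by
        have := dist_triangle z x p
        rw [dist_comm z x] at this
        linarith
      obtain ⟨q, hq, hzq⟩ := hf p (hP p hp) z hz hzp
      exact ⟨q, Finset.mem_biUnion.2 ⟨p, hp, hq⟩, hzq⟩

theorem chainReach_of_length {X : Type*} [MetricSpace X] {S : Set X} {η D : ℝ} (hη : 0 < η)
    {x y : X} (h : lengthEDistIn S x y ≤ ENNReal.ofReal D) (hD : 0 < D) :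
    ChainReach S η ⌈(D + 1) / η⌉₊ x y := by
  have hlt : lengthEDistIn S x y < ENNReal.ofReal (D + 1) :=
    h.trans_lt ((ENNReal.ofReal_lt_ofReal_iff (by linarith)).2 (by linarith))
  unfold lengthEDistIn at hlt
  simp only [iInf_lt_iff] at hlt
  obtain ⟨γ, hc, h0, h1, hS, hv⟩ := hlt
  have := chainReach_path hη.le hc hS ⌈(D + 1) / η⌉₊ 0 ⟨le_rfl, zero_le_one⟩ (by
    refine hv.le.trans ?_
    rw [← ENNReal.ofReal_natCast, ← ENNReal.ofReal_mul (by positivity)]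
    apply ENNReal.ofReal_le_ofReal
    rw [← div_le_iff₀ hη]
    exact Nat.le_ceil _)
  rwa [h0, h1] at this

/-- The paper's Theorem on manifolds with boundary, case (3) (metric-measure form):
length spaces with an `A`-interior-doubling measure, whose `r_i`-interiors have
intrinsic diameter `≤ D` for a fixed sequence `r_i → 0`, and whose boundaries (in the
completion, with the restricted metric) are uniformly totally bounded with bound `B`,
form a uniformly totally bounded family, hence a Gromov–Hausdorff precompact one. -/
theorem precompact_boundaries_uniformly_totallyBounded (D : ℝ) (hD : 0 < D)
    (r : ℕ → ℝ) (hr_pos : ∀ i, 0 < r i) (hr_lim : Filter.Tendsto r Filter.atTop (nhds 0))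
    (A : ℝ → ℝ≥0) (hA_mono : ∀ a b : ℝ, 0 < a → a ≤ b → A a ≤ A b)
    (hA_one : ∀ a : ℝ, 0 < a → 1 ≤ A a) :
    ∀ B : ℝ → ℕ, ∃ N : ℝ → ℕ,
      ∀ (X : Type) [MetricSpace X] [MeasurableSpace X] [BorelSpace X] (μ : Measure X),
        IsLengthSpace X → InteriorDoubling μ A →
        (∀ i : ℕ, ∀ x ∈ rInterior X (r i), ∀ y ∈ rInterior X (r i),
          lengthEDistIn (rInterior X (r i)) x y ≤ ENNReal.ofReal D) →
        (∀ ε : ℝ, 0 < ε →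
          ∃ F : Finset (UniformSpace.Completion X), ↑F ⊆ completionBoundary X ∧
            F.card ≤ B ε ∧
            ∀ q ∈ completionBoundary X, ∃ y ∈ F, dist q y < ε) →
        ∀ ε : ℝ, 0 < ε →
          ∃ F : Finset X, F.card ≤ N ε ∧ ∀ x : X, ∃ y ∈ F, dist x y < ε := by
  classical
  intro B
  suffices H : ∀ ε : ℝ, ∃ N : ℕ, 0 < ε →
      ∀ (X : Type) [MetricSpace X] [MeasurableSpace X] [BorelSpace X] (μ : Measure X),
        IsLengthSpace X → InteriorDoubling μ A →
        (∀ i : ℕ, ∀ x ∈ rInterior X (r i), ∀ y ∈ rInterior X (r i),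
          lengthEDistIn (rInterior X (r i)) x y ≤ ENNReal.ofReal D) →
        (∀ ε : ℝ, 0 < ε →
          ∃ F : Finset (UniformSpace.Completion X), ↑F ⊆ completionBoundary X ∧
            F.card ≤ B ε ∧
            ∀ q ∈ completionBoundary X, ∃ y ∈ F, dist q y < ε) →
          ∃ F : Finset X, F.card ≤ N ∧ ∀ x : X, ∃ y ∈ F, dist x y < ε by
    choose N hN using H
    exact ⟨N, fun X _ _ _ μ h1 h2 h3 h4 ε hε => hN ε hε X μ h1 h2 h3 h4⟩
  intro ε
  by_cases hε : 0 < ε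
  swap
  · exact ⟨0, fun h => absurd h hε⟩
  obtain ⟨i, hi⟩ := (hr_lim.eventually_lt_const (show (0 : ℝ) < ε / 4 by positivity)).exists
  have hri := hr_pos i
  set s : ℝ := r i / 4 with hs
  have hs0 : 0 < s := by positivity
  refine ⟨B (ε / 4) + ⌈(A (r i)) ^ 4⌉₊ ^ ⌈(D + 1) / (s / 2)⌉₊, fun _ => ?_⟩
  intro X _ _ _ μ _ hμ hlen hbd
  obtain ⟨F, -, hFc, hF⟩ := hbd (ε / 4) (by positivity)
  have happ : ∀ q : UniformSpace.Completion X, ∃ x : X,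
      dist q (x : UniformSpace.Completion X) < ε / 4 := fun q =>
    UniformSpace.Completion.denseRange_coe.exists_dist_lt q (by positivity)
  choose g hg using happ
  have hint : ∃ Q : Finset X, Q.card ≤ ⌈(A (r i)) ^ 4⌉₊ ^ ⌈(D + 1) / (s / 2)⌉₊ ∧
      ∀ y ∈ rInterior X (r i), ∃ q ∈ Q, dist y q < s / 2 := by
    rcases (rInterior X (r i)).eq_empty_or_nonempty with he | ⟨x₀, hx₀⟩
    · exact ⟨∅, by simp, by simp [he]⟩
    · obtain ⟨Q, hQc, hQ⟩ := chain_cover (S := rInterior X (r i)) (s := s)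
        (K := ⌈(A (r i)) ^ 4⌉₊)
        (fun p hp => local_cover_s11 hs0 fun Q h1 h2 =>
          card_sep_le hA_mono hμ hs0 (by linarith) hp Q h1 h2)
        ⌈(D + 1) / (s / 2)⌉₊ {x₀} (by simpa using hx₀)
      refine ⟨Q, by simpa using hQc, fun y hy => ?_⟩
      exact hQ x₀ y ⟨x₀, by simp, by simpa using hs0⟩
        (chainReach_of_length (by positivity) (hlen i x₀ hx₀ y hy) hD)
  obtain ⟨Q, hQc, hQ⟩ := hint
  refine ⟨F.image g ∪ Q, ?_, fun x => ?_⟩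
  · refine (Finset.card_union_le _ _).trans ?_
    have := (Finset.card_image_le (s := F) (f := g)).trans hFc
    omega
  · by_cases hx : x ∈ rInterior X (r i)
    · obtain ⟨q, hq, hxq⟩ := hQ x hx
      exact ⟨q, Finset.mem_union_right _ hq, by linarith⟩
    · have hx' : Metric.infEDist ((x : X) : UniformSpace.Completion X) (completionBoundary X)
          ≤ ENNReal.ofReal (r i) := not_lt.1 hx
      have hlt := hx'.trans_lt ((ENNReal.ofReal_lt_ofReal_iff (show 0 < ε / 4 by positivity)).2 hi)
      obtain ⟨q, hq, hxq⟩ := Metric.infEDist_lt_iff.1 hlt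
      rw [edist_dist, ENNReal.ofReal_lt_ofReal_iff (by positivity)] at hxq
      obtain ⟨y, hy, hqy⟩ := hF q hq
      refine ⟨g y, Finset.mem_union_left _ (Finset.mem_image_of_mem g hy), ?_⟩
      rw [← UniformSpace.Completion.dist_eq]
      have h1 := hg y
      have h2 := dist_triangle4 (x : UniformSpace.Completion X) q y (g y)
      linarith
end
end

section
/- Fix r₀>0 and A₀≥1. Let 𝒟 be a family of pointed metric spaces (W,d_W,p) where W is a closed domain in a length space (X,d) with basepoint p∈∂W, the closure of the r₀-neighborhood B_{r₀}(W,X) in X is complete, X carries a Borel measure that is (r₀,A₀)-doubling along W, and the family of intrinsic boundaries {(∂W, d_W, p)} (each ∂W equipped with the metric of the completion of (W,d_W)) is uniformly totally bounded. Then 𝒟 itself is uniformly totally bounded, hence precompact in the pointed Gromov–Hausdorff topology. -/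
open Set Metric Filter MeasureTheory ENNReal NNReal

noncomputable section

/-- A sequence is Cauchy with respect to the induced length metric of `S`. -/
def IsCauchyIn {X : Type*} [MetricSpace X] (S : Set X) (u : ℕ → X) : Prop :=
  ∀ ε : ℝ≥0∞, 0 < ε → ∃ N : ℕ, ∀ m ≥ N, ∀ n ≥ N, lengthEDistIn S (u m) (u n) < ε

/-- A sequence converges to `w` with respect to the induced length metric of `S`. -/
def ConvergesIn {X : Type*} [MetricSpace X] (S : Set X) (u : ℕ → X) (w : X) : Prop :=
  Filter.Tendsto (fun n => lengthEDistIn S (u n) w) Filter.atTop (nhds 0)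

/-- The `t`-interior `W_t° = {x ∈ W : d_W(x, ∂W) > t}` of `W`, where `∂W` is the
boundary of the topological interior `W°` in the metric completion of `(W, d_W)`,
expressed without forming the completion: `x ∈ W_t°` iff for some `r > t`, every
point of the completion at `d_W`-distance `< r` from `x` (i.e. every `d_W`-Cauchy
sequence in `W` eventually staying within `d_W`-distance `< r` of `x`) is the image of
a point of the interior `W°`. -/
def IntrinsicInterior {X : Type*} [MetricSpace X] (W : Set X) (t : ℝ) : Set X :=
  {x ∈ W | ∃ r : ℝ, t < r ∧ ∀ u : ℕ → X, (∀ n, u n ∈ W) → IsCauchyIn W u →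
    (∃ c : ℝ, c < r ∧ ∀ᶠ n in Filter.atTop, lengthEDistIn W x (u n) ≤ ENNReal.ofReal c) →
    ∃ w ∈ interior W, ConvergesIn W u w}

/-- A domain in a space: a connected subset whose topological interior has the same
closure as the set itself. -/
def IsDomainIn {X : Type*} [TopologicalSpace X] (W : Set X) : Prop :=
  IsConnected W ∧ closure (interior W) = closure W

/-- `W` is an `(s(t), t₀)`-undistorted domain: for every `0 < t ≤ t₀` the closure in
`(W, d_W)` of the `s(t)`-neighborhood of the `t`-interior `W_t°` contains all of `W`. -/
def UndistortedDomain {X : Type*} [MetricSpace X] (W : Set X) (s : ℝ → ℝ) (t₀ : ℝ) : Prop :=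
  ∀ t : ℝ, 0 < t → t ≤ t₀ →
    ∀ x ∈ W, ∀ ε : ℝ, 0 < ε → ∃ y ∈ W,
      lengthEDistIn W x y < ENNReal.ofReal ε ∧
      ∃ z ∈ IntrinsicInterior W t, lengthEDistIn W y z < ENNReal.ofReal (s t)

/-- The measure `μ` is `(r₀, A₀)`-doubling along `W`: the doubling condition holds for
all balls of radius `≤ r₀` centered in the open `r₀`-neighborhood of `W`. -/
def DoublingAlong {X : Type*} [MetricSpace X] [MeasurableSpace X]
    (μ : Measure X) (W : Set X) (r₀ : ℝ) (A₀ : ℝ≥0) : Prop :=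
  ∀ x : X, (∃ w ∈ W, dist x w < r₀) → ∀ r : ℝ, 0 < r → r ≤ r₀ →
    0 < μ (Metric.ball x r) ∧
    μ (Metric.ball x r) ≤ (A₀ : ℝ≥0∞) * μ (Metric.ball x (r / 2)) ∧
    (A₀ : ℝ≥0∞) * μ (Metric.ball x (r / 2)) < ⊤

/-- The intrinsic boundary points of `W` lying in `W`: points of `W` at zero intrinsic
distance from the boundary `∂W` of `W°` in the completion of `(W, d_W)`. -/
def IntrinsicBoundaryIn {X : Type*} [MetricSpace X] (W : Set X) : Set X :=
  W \ IntrinsicInterior W 0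

theorem led_le_of_path {X : Type*} [PseudoEMetricSpace X] {S : Set X} {γ : ℝ → X} {a b : ℝ}
    (hab : a ≤ b) (hc : ContinuousOn γ (Set.Icc a b)) (hm : Set.MapsTo γ (Set.Icc a b) S) :
    lengthEDistIn S (γ a) (γ b) ≤ eVariationOn γ (Set.Icc a b) := by
  have hmaps : Set.MapsTo (fun u : ℝ => a + (b - a) * u) (Set.Icc 0 1) (Set.Icc a b) := by
    intro u hu
    constructor
    · nlinarith [hu.1, hu.2]
    · nlinarith [hu.1, hu.2]
  have hmono : MonotoneOn (fun u : ℝ => a + (b - a) * u) (Set.Icc 0 1) := by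
    intro u _ v _ huv
    simp only
    nlinarith
  unfold lengthEDistIn
  refine iInf_le_of_le (γ ∘ fun u : ℝ => a + (b - a) * u) ?_
  refine iInf_le_of_le (hc.comp (by fun_prop) hmaps) ?_
  refine iInf_le_of_le (by simp) ?_
  refine iInf_le_of_le (by simp) ?_
  refine iInf_le_of_le (hm.comp hmaps) ?_
  exact eVariationOn.comp_le_of_monotoneOn γ _ hmono hmaps

theorem led_exists_path {X : Type*} [PseudoEMetricSpace X] {S : Set X} {x y : X} {L : ℝ≥0∞}
    (h : lengthEDistIn S x y < L) : ∃ γ : ℝ → X, ContinuousOn γ (Set.Icc 0 1) ∧ γ 0 = x ∧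
      γ 1 = y ∧ Set.MapsTo γ (Set.Icc 0 1) S ∧ eVariationOn γ (Set.Icc 0 1) < L := by
  unfold lengthEDistIn at h
  simp only [iInf_lt_iff] at h
  obtain ⟨γ, h1, h2, h3, h4, h5⟩ := h
  exact ⟨γ, h1, h2, h3, h4, h5⟩

theorem led_edist_le {X : Type*} [PseudoEMetricSpace X] {S : Set X} (x y : X) :
    edist x y ≤ lengthEDistIn S x y := by
  by_contra h
  push Not at h
  obtain ⟨γ, h1, h2, h3, h4, h5⟩ := led_exists_path h
  have := eVariationOn.edist_le γ (s := Set.Icc (0:ℝ) 1) (x := 0) (y := 1) (by simp) (by simp)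
  rw [h2, h3] at this
  exact absurd h5 (not_lt.2 this)

theorem led_self {X : Type*} [PseudoEMetricSpace X] {S : Set X} {x : X} (hx : x ∈ S) :
    lengthEDistIn S x x = 0 := by
  have h := led_le_of_path (S := S) (γ := fun _ : ℝ => x) (a := 0) (b := 0) le_rfl
    continuousOn_const (fun _ _ => hx)
  have h2 : eVariationOn (fun _ : ℝ => x) (Set.Icc 0 0) = 0 :=
    eVariationOn.subsingleton _ (by simp)
  simpa [h2] using h

theorem led_triangle {X : Type*} [PseudoEMetricSpace X] {S : Set X} {x y z : X} {L M : ℝ≥0∞}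
    (hL : lengthEDistIn S x y < L) (hM : lengthEDistIn S y z < M) :
    lengthEDistIn S x z < L + M := by
  obtain ⟨γ, h1, h2, h3, h4, h5⟩ := led_exists_path hL
  obtain ⟨τ, k1, k2, k3, k4, k5⟩ := led_exists_path hM
  set f : ℝ → X := fun u => if u ≤ 1 then γ u else τ (u - 1) with hf
  have e1 : Set.EqOn f γ (Set.Icc 0 1) := by
    intro u hu
    simp [hf, hu.2]
  have e2 : Set.EqOn f (τ ∘ fun u => u - 1) (Set.Icc 1 2) := by
    intro u hu
    by_cases h : u ≤ 1
    · have : u = 1 := le_antisymm h hu.1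
      subst this
      simp [hf, h3, k2]
    · simp [hf, h]
  have hmaps : Set.MapsTo (fun u : ℝ => u - 1) (Set.Icc 1 2) (Set.Icc 0 1) := by
    intro u hu
    exact ⟨by linarith [hu.1], by linarith [hu.2]⟩
  have hmono : MonotoneOn (fun u : ℝ => u - 1) (Set.Icc 1 2) := by
    intro u _ v _ huv
    simp only
    linarith
  have hU : Set.Icc (0:ℝ) 1 ∪ Set.Icc 1 2 = Set.Icc 0 2 :=
    Set.Icc_union_Icc_eq_Icc (by norm_num) (by norm_num)
  have c1 : ContinuousOn f (Set.Icc 0 1) := h1.congr e1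
  have c2 : ContinuousOn f (Set.Icc 1 2) := (k1.comp (by fun_prop) hmaps).congr e2
  have c : ContinuousOn f (Set.Icc 0 2) := by
    rw [← hU]
    exact c1.union_of_isClosed c2 isClosed_Icc isClosed_Icc
  have m : Set.MapsTo f (Set.Icc 0 2) S := by
    rw [← hU]
    rintro u (hu | hu)
    · rw [e1 hu]; exact h4 hu
    · rw [e2 hu]; exact k4 (hmaps hu)
  have h6 := led_le_of_path (by norm_num) c m
  have h7 : eVariationOn f (Set.Icc 0 2) = eVariationOn f (Set.Icc 0 1) + eVariationOn f (Set.Icc 1 2) := by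
    rw [← hU]
    exact eVariationOn.union f (x := 1) (isGreatest_Icc (by norm_num)) (isLeast_Icc (by norm_num))
  rw [h7, eVariationOn.congr e1, eVariationOn.congr e2] at h6
  have h8 := eVariationOn.comp_le_of_monotoneOn τ _ hmono hmaps
  have f0 : f 0 = x := by simp [hf, h2]
  have f2 : f 2 = z := by
    have : (2:ℝ) - 1 = 1 := by norm_num
    simp [hf, this, k3]
  rw [f0, f2] at h6
  exact h6.trans_lt (ENNReal.add_lt_add h5 (h8.trans_lt k5))

theorem boundary_of_not_interior {X : Type*} [MetricSpace X] {W : Set X} {q : X} (hq : q ∈ W)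
    (hq' : q ∉ interior W) : q ∈ IntrinsicBoundaryIn W := by
  refine ⟨hq, ?_⟩
  rintro ⟨-, r, hr, h⟩
  obtain ⟨w, hw, hc⟩ := h (fun _ => q) (fun _ => hq)
    (fun ε hε => ⟨0, fun _ _ _ _ => by simpa [led_self hq] using hε⟩)
    ⟨0, hr, Filter.Eventually.of_forall fun _ => by simp [led_self hq]⟩
  have h0 : lengthEDistIn W q w = 0 := tendsto_const_nhds_iff.1 hc
  have h1 : edist q w ≤ 0 := h0 ▸ led_edist_le q w
  have : q = w := by simpa using h1
  exact hq' (this ▸ hw)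

/-- away from the boundary the intrinsic and extrinsic balls agree -/
theorem led_lt_of_deep {X : Type*} [MetricSpace X] {W : Set X} (hX : IsLengthSpace X)
    (hW : IsClosed W) {x z : X} {δ : ℝ} (hx : x ∈ W)
    (hdeep : ∀ q ∈ IntrinsicBoundaryIn W, ¬ lengthEDistIn W x q < ENNReal.ofReal δ)
    (hz : dist x z < δ) : lengthEDistIn W x z < ENNReal.ofReal δ := by
  have h0 : lengthEDistIn Set.univ x z < ENNReal.ofReal δ := by
    rw [← hX, edist_dist]
    exact (ENNReal.ofReal_lt_ofReal_iff (dist_nonneg.trans_lt hz)).2 hz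
  obtain ⟨γ, h1, h2, h3, -, h5⟩ := led_exists_path h0
  by_cases hall : Set.MapsTo γ (Set.Icc 0 1) W
  · have := led_le_of_path zero_le_one h1 hall
    rw [h2, h3] at this
    exact this.trans_lt h5
  exfalso
  set E : Set ℝ := {t | t ∈ Set.Icc (0:ℝ) 1 ∧ γ t ∉ W} with hE
  have hne : E.Nonempty := by
    by_contra hn
    apply hall
    intro t ht
    by_contra h
    exact hn ⟨t, ht, h⟩
  have hbd : BddBelow E := ⟨0, fun t ht => ht.1.1⟩
  set t₀ := sInf E with ht₀
  have hcl : t₀ ∈ closure E := csInf_mem_closure hne hbd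
  have h01 : t₀ ∈ Set.Icc (0:ℝ) 1 :=
    closure_minimal (fun t ht => ht.1) isClosed_Icc hcl
  have hlow : ∀ t, 0 ≤ t → t < t₀ → γ t ∈ W := by
    intro t ht0 htt
    by_contra h
    exact absurd (csInf_le hbd (show t ∈ E from ⟨⟨ht0, htt.le.trans h01.2⟩, h⟩)) (not_le.2 htt)
  have hW0 : γ t₀ ∈ W := by
    rcases h01.1.eq_or_lt with h | h
    · rw [← h, h2]; exact hx
    · have hcl2 : t₀ ∈ closure (Set.Ico 0 t₀) := by
        rw [closure_Ico h.ne]; exact ⟨h.le, le_rfl⟩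
      have hcw : ContinuousWithinAt γ (Set.Ico 0 t₀) t₀ :=
        (h1 t₀ h01).mono (fun t ht => ⟨ht.1, ht.2.le.trans h01.2⟩)
      have := hcw.mem_closure hcl2 (t := W) (fun t ht => hlow t ht.1 ht.2)
      rwa [hW.closure_eq] at this
  have hnint : γ t₀ ∉ interior W := by
    have hcw : ContinuousWithinAt γ E t₀ := (h1 t₀ h01).mono (fun t ht => ht.1)
    have := hcw.mem_closure hcl (t := Wᶜ) (fun t ht => ht.2)
    rwa [closure_compl] at this
  have hmap : Set.MapsTo γ (Set.Icc 0 t₀) W := by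
    intro t ht
    rcases ht.2.eq_or_lt with h | h
    · rw [h]; exact hW0
    · exact hlow t ht.1 h
  have hs : Set.Icc 0 t₀ ⊆ Set.Icc (0:ℝ) 1 := Set.Icc_subset_Icc_right h01.2
  have h6 := led_le_of_path h01.1 (h1.mono hs) hmap
  rw [h2] at h6
  exact hdeep _ (boundary_of_not_interior hW0 hnint)
    ((h6.trans (eVariationOn.mono γ hs)).trans_lt h5)

theorem doubling_iter {X : Type*} [MetricSpace X] [MeasurableSpace X] {μ : Measure X} {W : Set X}
    {r₀ : ℝ} (hr₀ : 0 < r₀) {A₀ : ℝ≥0} (hD : DoublingAlong μ W r₀ A₀) {x : X} (hx : x ∈ W)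
    (m : ℕ) : μ (Metric.ball x r₀) ≤ (A₀ : ℝ≥0∞) ^ m * μ (Metric.ball x (r₀ / 2 ^ m)) := by
  induction m with
  | zero => simp
  | succ m ih =>
    have hp : (0:ℝ) < 2 ^ m := by positivity
    have h := (hD x ⟨x, hx, by simpa using hr₀⟩ (r₀ / 2 ^ m) (by positivity)
      (div_le_self hr₀.le (one_le_pow₀ (by norm_num)))).2.1
    have e : r₀ / 2 ^ m / 2 = r₀ / 2 ^ (m + 1) := by rw [pow_succ]; field_simp
    rw [e] at h
    calc _ ≤ _ := ih
      _ ≤ (A₀ : ℝ≥0∞) ^ m * (A₀ * μ (Metric.ball x (r₀ / 2 ^ (m + 1)))) := by gcongr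
      _ = _ := by rw [pow_succ]; ring

theorem packing_card {X : Type*} [MetricSpace X] [MeasurableSpace X] [BorelSpace X]
    {μ : Measure X} {W : Set X}
    {r₀ : ℝ} (hr₀ : 0 < r₀) {A₀ : ℝ≥0} (hD : DoublingAlong μ W r₀ A₀) {c : X} (hc : c ∈ W)
    (m : ℕ) (hm : 2 ≤ m) (F : Finset X) (hFW : ∀ x ∈ F, x ∈ W)
    (hFc : ∀ x ∈ F, dist x c < r₀ / 4)
    (hsep : ∀ x ∈ F, ∀ y ∈ F, x ≠ y → 2 * (r₀ / 2 ^ m) ≤ dist x y) :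
    F.card ≤ ⌈A₀ ^ m⌉₊ := by
  have hD1 := hD c ⟨c, hc, by simpa using hr₀⟩ (r₀ / 2) (by positivity) (by linarith)
  set V := μ (Metric.ball c (r₀ / 2)) with hV
  have hVtop : V < ⊤ := hD1.2.1.trans_lt hD1.2.2
  have hρ : r₀ / 2 ^ m ≤ r₀ / 4 := by
    have : (4:ℝ) ≤ 2 ^ m := by
      calc (4:ℝ) = 2 ^ 2 := by norm_num
        _ ≤ 2 ^ m := pow_le_pow_right₀ (by norm_num) hm
    gcongr
  have h1 : ∑ x ∈ F, μ (Metric.ball x (r₀ / 2 ^ m)) ≤ V := by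
    rw [← measure_biUnion_finset (f := fun x => Metric.ball x (r₀ / 2 ^ m))]
    · apply measure_mono
      intro z hz
      simp only [Set.mem_iUnion, Metric.mem_ball] at hz ⊢
      obtain ⟨x, hx, hzx⟩ := hz
      have := dist_triangle z x c
      have := hFc x hx
      linarith
    · intro x hx y hy hxy
      apply Metric.ball_disjoint_ball
      have := hsep x hx y hy hxy
      linarith
    · intro x _
      exact Metric.isOpen_ball.measurableSet
  have h2 : ∀ x ∈ F, V ≤ (A₀ : ℝ≥0∞) ^ m * μ (Metric.ball x (r₀ / 2 ^ m)) := by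
    intro x hx
    refine le_trans (measure_mono ?_) (doubling_iter hr₀ hD (hFW x hx) m)
    apply Metric.ball_subset_ball'
    have := hFc x hx
    rw [dist_comm] at this
    linarith
  have h3 : (F.card : ℝ≥0∞) * V ≤ (A₀ : ℝ≥0∞) ^ m * V := by
    calc (F.card : ℝ≥0∞) * V = ∑ x ∈ F, V := by simp
      _ ≤ ∑ x ∈ F, (A₀ : ℝ≥0∞) ^ m * μ (Metric.ball x (r₀ / 2 ^ m)) := Finset.sum_le_sum h2
      _ = (A₀ : ℝ≥0∞) ^ m * ∑ x ∈ F, μ (Metric.ball x (r₀ / 2 ^ m)) := by rw [Finset.mul_sum]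
      _ ≤ _ := by gcongr
  have h4 : (F.card : ℝ≥0∞) ≤ (A₀ : ℝ≥0∞) ^ m :=
    (ENNReal.mul_le_mul_iff_left hD1.1.ne' hVtop.ne).1 h3
  have h5 : (F.card : ℝ≥0) ≤ A₀ ^ m := by exact_mod_cast h4
  exact_mod_cast h5.trans (Nat.le_ceil _)

theorem net_exists {X : Type*} [MetricSpace X] [MeasurableSpace X] [BorelSpace X]
    {μ : Measure X} {W : Set X}
    {r₀ : ℝ} (hr₀ : 0 < r₀) {A₀ : ℝ≥0} (hD : DoublingAlong μ W r₀ A₀) {c : X} (hc : c ∈ W)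
    (m : ℕ) (hm : 2 ≤ m) (T : Set X) (hTW : T ⊆ W) (hTc : ∀ x ∈ T, dist x c < r₀ / 4) :
    ∃ F : Finset X, ↑F ⊆ T ∧ F.card ≤ ⌈A₀ ^ m⌉₊ ∧
      ∀ x ∈ T, ∃ y ∈ F, dist x y < 2 * (r₀ / 2 ^ m) := by
  classical
  by_contra hcon
  push Not at hcon
  have key : ∀ n : ℕ, n ≤ ⌈A₀ ^ m⌉₊ + 1 → ∃ F : Finset X, ↑F ⊆ T ∧ F.card = n ∧
      ∀ x ∈ F, ∀ y ∈ F, x ≠ y → 2 * (r₀ / 2 ^ m) ≤ dist x y := by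
    intro n
    induction n with
    | zero => intro _; exact ⟨∅, by simp, by simp, by simp⟩
    | succ n ih =>
      intro hn
      obtain ⟨F, hF, hcard, hsep⟩ := ih (by omega)
      obtain ⟨x, hx, hxF⟩ := hcon F hF (by omega)
      have hpos : 0 < 2 * (r₀ / 2 ^ m) := by positivity
      have hnx : x ∉ F := by
        intro h
        have := hxF x h
        rw [dist_self] at this
        linarith
      refine ⟨insert x F, ?_, ?_, ?_⟩
      · rw [Finset.coe_insert]
        exact Set.insert_subset hx hF
      · rw [Finset.card_insert_of_notMem hnx, hcard]
      · intro a ha b hb hab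
        rw [Finset.mem_insert] at ha hb
        rcases ha with rfl | ha <;> rcases hb with rfl | hb
        · exact absurd rfl hab
        · exact hxF b hb
        · rw [dist_comm]; exact hxF a ha
        · exact hsep a ha b hb hab
  obtain ⟨F, hF, hcard, hsep⟩ := key _ le_rfl
  have := packing_card hr₀ hD hc m hm F (fun x hx => hTW (hF hx)) (fun x hx => hTc x (hF hx)) hsep
  omega

theorem chain_cover_s12 {X : Type*} [MetricSpace X] [MeasurableSpace X] [BorelSpace X]
    {μ : Measure X} {W : Set X}
    {r₀ : ℝ} (hr₀ : 0 < r₀) {A₀ : ℝ≥0} (hD : DoublingAlong μ W r₀ A₀) {p : X} (hp : p ∈ W)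
    (k : ℕ) : ∃ F : Finset X, ↑F ⊆ W ∧ F.card ≤ ⌈A₀ ^ 4⌉₊ ^ k ∧
      ∀ x ∈ W, lengthEDistIn W p x < ENNReal.ofReal ((k + 1) * (r₀ / 16)) →
        ∃ y ∈ F, dist x y < r₀ / 8 := by
  classical
  have hlt : ∀ x : X, ∀ a : ℝ, 0 < a → lengthEDistIn W p x < ENNReal.ofReal a → dist x p < a := by
    intro x a ha h
    have := (led_edist_le (S := W) p x).trans_lt h
    rw [edist_dist, ENNReal.ofReal_lt_ofReal_iff ha] at this
    rwa [dist_comm]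
  induction k with
  | zero =>
    refine ⟨{p}, by simpa using hp, by simp, ?_⟩
    intro x _ h
    refine ⟨p, by simp, ?_⟩
    have := hlt x _ (by positivity) h
    simp at this
    linarith
  | succ k ih =>
    obtain ⟨F, hFW, hcard, hF⟩ := ih
    have hnet : ∀ c : X, ∃ G : Finset X, c ∈ F → (↑G ⊆ W ∧ G.card ≤ ⌈A₀ ^ 4⌉₊ ∧
        ∀ x ∈ W, dist x c < r₀ / 4 → ∃ y ∈ G, dist x y < r₀ / 8) := by
      intro c
      by_cases hc : c ∈ F
      · obtain ⟨G, h1, h2, h3⟩ := net_exists hr₀ hD (hFW hc) 4 (by norm_num)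
          {x | x ∈ W ∧ dist x c < r₀ / 4} (fun x hx => hx.1) (fun x hx => hx.2)
        refine ⟨G, fun _ => ⟨fun x hx => (h1 hx).1, h2, fun x hx hxc => ?_⟩⟩
        obtain ⟨y, hy, hxy⟩ := h3 x ⟨hx, hxc⟩
        refine ⟨y, hy, hxy.trans_le (le_of_eq ?_)⟩
        ring
      · exact ⟨∅, fun h => absurd h hc⟩
    choose G hG using hnet
    refine ⟨F.biUnion G, ?_, ?_, ?_⟩
    · intro y hy
      rw [Finset.mem_coe, Finset.mem_biUnion] at hy
      obtain ⟨c, hc, hy⟩ := hy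
      exact (hG c hc).1 hy
    · refine (Finset.card_biUnion_le_card_mul F G _ (fun c hc => (hG c hc).2.1)).trans ?_
      rw [pow_succ]
      exact Nat.mul_le_mul_right _ hcard
    · intro x hx hpx
      have hy : ∃ y ∈ W, lengthEDistIn W p y < ENNReal.ofReal ((k + 1) * (r₀ / 16)) ∧
          dist x y ≤ r₀ / 16 := by
        by_cases hnear : dist p x ≤ r₀ / 16
        · refine ⟨p, hp, ?_, by rwa [dist_comm]⟩
          rw [led_self hp]
          exact ENNReal.ofReal_pos.2 (by positivity)
        push Not at hnear
        obtain ⟨γ, h1, h2, h3, h4, h5⟩ := led_exists_path hpx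
        have hcd : ContinuousOn (fun t => dist (γ t) x) (Set.Icc 0 1) :=
          fun t ht => Filter.Tendsto.dist (h1 t ht) tendsto_const_nhds
        obtain ⟨t, ht, hdt⟩ := intermediate_value_Icc' zero_le_one hcd
          (show r₀ / 16 ∈ Set.Icc (dist (γ 1) x) (dist (γ 0) x) by
            rw [h2, h3, dist_self]
            exact ⟨by positivity, hnear.le⟩)
        simp only at hdt
        refine ⟨γ t, h4 ht, ?_, by rw [dist_comm]; exact hdt.le⟩
        have hs : Set.Icc 0 t ⊆ Set.Icc (0:ℝ) 1 := Set.Icc_subset_Icc_right ht.2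
        have h6 := led_le_of_path ht.1 (h1.mono hs) (h4.mono_left hs)
        rw [h2] at h6
        have h7 : eVariationOn γ (Set.Icc 0 t) + eVariationOn γ (Set.Icc t 1)
            = eVariationOn γ (Set.Icc 0 1) := by
          rw [← Set.Icc_union_Icc_eq_Icc ht.1 ht.2]
          exact (eVariationOn.union γ (x := t) (isGreatest_Icc ht.1) (isLeast_Icc ht.2)).symm
        have h8 : ENNReal.ofReal (r₀ / 16) ≤ eVariationOn γ (Set.Icc t 1) := by
          have := eVariationOn.edist_le γ (s := Set.Icc t 1) (x := t) (y := 1)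
            ⟨le_rfl, ht.2⟩ ⟨ht.2, le_rfl⟩
          rwa [h3, edist_dist, hdt] at this
        have h9 : lengthEDistIn W p (γ t) + ENNReal.ofReal (r₀ / 16) <
            ENNReal.ofReal ((k + 1) * (r₀ / 16)) + ENNReal.ofReal (r₀ / 16) := by
          rw [← ENNReal.ofReal_add (by positivity) (by positivity)]
          refine (add_le_add h6 h8).trans_lt ?_
          rw [h7]
          refine h5.trans_le (le_of_eq ?_)
          congr 1
          push_cast
          ring
        exact lt_of_add_lt_add_right h9
      obtain ⟨y, hyW, hpy, hxy⟩ := hy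
      obtain ⟨c, hc, hyc⟩ := hF y hyW hpy
      have := dist_triangle x y c
      obtain ⟨z, hz, hxz⟩ := (hG c hc).2.2 x hx (by linarith)
      exact ⟨z, Finset.mem_biUnion.2 ⟨c, hc, hz⟩, hxz⟩

/-- The paper's theorem on closed domains with Gromov–Hausdorff precompact boundaries
(metric-measure form): if the pointed intrinsic boundaries `(∂W, d_W, p)` are uniformly
totally bounded with bound `B`, then the pointed closed domains `(W, d_W, p)`, whose
`r₀`-neighborhoods have complete closure and which carry a measure `(r₀, A₀)`-doubling
along `W`, are uniformly totally bounded with a bound `N` depending only on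
`r₀, A₀, B` — hence precompact in the pointed Gromov–Hausdorff topology. -/
theorem closed_domains_with_precompact_boundary_uniformly_totallyBounded
    (r₀ : ℝ) (hr₀ : 0 < r₀) (A₀ : ℝ≥0) (hA₀ : 1 ≤ A₀) :
    ∀ B : ℝ → ℝ → ℕ, ∃ N : ℝ → ℝ → ℕ,
      ∀ (X : Type) [MetricSpace X] [MeasurableSpace X] [BorelSpace X]
        (μ : Measure X) (W : Set X) (p : X),
        IsLengthSpace X → IsDomainIn W → IsClosed W →
        p ∈ IntrinsicBoundaryIn W →
        IsComplete (closure {z : X | ∃ w ∈ W, dist z w < r₀}) →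
        DoublingAlong μ W r₀ A₀ →
        (∀ R ε : ℝ, 0 < R → 0 < ε →
          ∃ F : Finset X, ↑F ⊆ IntrinsicBoundaryIn W ∧ F.card ≤ B R ε ∧
            ∀ x ∈ IntrinsicBoundaryIn W, lengthEDistIn W p x < ENNReal.ofReal R →
              ∃ y ∈ F, lengthEDistIn W x y < ENNReal.ofReal ε) →
        ∀ R ε : ℝ, 0 < R → 0 < ε →
          ∃ F : Finset X, ↑F ⊆ W ∧ F.card ≤ N R ε ∧
            ∀ x ∈ W, lengthEDistIn W p x < ENNReal.ofReal R →
              ∃ y ∈ F, lengthEDistIn W x y < ENNReal.ofReal ε := by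
  classical
  intro B
  have hkex : ∀ R : ℝ, ∃ k : ℕ, R ≤ (k + 1) * (r₀ / 16) := by
    intro R
    obtain ⟨k, hk⟩ := exists_nat_ge (R / (r₀ / 16))
    refine ⟨k, ?_⟩
    rw [div_le_iff₀ (by positivity)] at hk
    nlinarith
  have hmex : ∀ ε : ℝ, ∃ m : ℕ, 0 < ε → 2 ≤ m ∧ 2 * (r₀ / 2 ^ m) ≤ ε / 2 := by
    intro ε
    by_cases hε : 0 < ε
    · obtain ⟨m, hm⟩ := pow_unbounded_of_one_lt (4 * r₀ / ε) (by norm_num : (1:ℝ) < 2)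
      refine ⟨m + 2, fun _ => ⟨by omega, ?_⟩⟩
      rw [div_lt_iff₀ hε] at hm
      have hp : (0:ℝ) < 2 ^ m := by positivity
      rw [pow_add, ← mul_div_assoc, div_le_iff₀ (by positivity)]
      nlinarith
    · exact ⟨0, fun h => absurd h hε⟩
  choose k hk using hkex
  choose m hm using hmex
  refine ⟨fun R ε => B (R + ε / 2) (ε / 2) + ⌈A₀ ^ 4⌉₊ ^ (k R) * ⌈A₀ ^ (m ε)⌉₊, ?_⟩
  intro X _ _ _ μ W p hX _ hWc hp _ hD hB R ε hR hε
  have hpW : p ∈ W := hp.1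
  obtain ⟨F₁, hF₁W, hF₁c, hF₁⟩ := hB (R + ε / 2) (ε / 2) (by positivity) (by positivity)
  obtain ⟨F, hFW, hFc, hF⟩ := chain_cover_s12 hr₀ hD hpW (k R)
  set D : Set X := {x | x ∈ W ∧ ∀ q ∈ IntrinsicBoundaryIn W,
    ¬ lengthEDistIn W x q < ENNReal.ofReal (ε / 2)} with hDdef
  have hnet : ∀ c : X, ∃ G : Finset X, c ∈ F → (↑G ⊆ D ∧ G.card ≤ ⌈A₀ ^ (m ε)⌉₊ ∧
      ∀ x ∈ D, dist x c < r₀ / 4 → ∃ y ∈ G, dist x y < 2 * (r₀ / 2 ^ (m ε))) := by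
    intro c
    by_cases hc : c ∈ F
    · obtain ⟨G, h1, h2, h3⟩ := net_exists hr₀ hD (hFW hc) (m ε) (hm ε hε).1
        {x | x ∈ D ∧ dist x c < r₀ / 4} (fun x hx => hx.1.1) (fun x hx => hx.2)
      exact ⟨G, fun _ => ⟨fun x hx => (h1 hx).1, h2, fun x hx hxc => h3 x ⟨hx, hxc⟩⟩⟩
    · exact ⟨∅, fun h => absurd h hc⟩
  choose G hG using hnet
  have hee : ENNReal.ofReal (ε / 2) + ENNReal.ofReal (ε / 2) = ENNReal.ofReal ε := by
    rw [← ENNReal.ofReal_add (by positivity) (by positivity), add_halves]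
  refine ⟨F₁ ∪ F.biUnion G, ?_, ?_, ?_⟩
  · intro y hy
    rw [Finset.mem_coe, Finset.mem_union, Finset.mem_biUnion] at hy
    rcases hy with hy | ⟨c, hc, hy⟩
    · exact (hF₁W hy).1
    · exact ((hG c hc).1 hy).1
  · refine (Finset.card_union_le _ _).trans (add_le_add hF₁c ?_)
    refine (Finset.card_biUnion_le_card_mul F G _ (fun c hc => (hG c hc).2.1)).trans ?_
    exact Nat.mul_le_mul_right _ hFc
  · intro x hx hpx
    by_cases hxD : x ∈ D
    · obtain ⟨c, hc, hxc⟩ := hF x hx (hpx.trans_le (ENNReal.ofReal_le_ofReal (hk R)))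
      obtain ⟨y, hy, hxy⟩ := (hG c hc).2.2 x hxD (by linarith)
      refine ⟨y, Finset.mem_union_right _ (Finset.mem_biUnion.2 ⟨c, hc, hy⟩), ?_⟩
      refine (led_lt_of_deep hX hWc hx hxD.2 (hxy.trans_le (hm ε hε).2)).trans_le ?_
      exact ENNReal.ofReal_le_ofReal (by linarith)
    · have : ∃ q ∈ IntrinsicBoundaryIn W, lengthEDistIn W x q < ENNReal.ofReal (ε / 2) := by
        by_contra h
        push Not at h
        exact hxD ⟨hx, fun q hq => not_lt.2 (h q hq)⟩
      obtain ⟨q, hq, hxq⟩ := this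
      have hpq : lengthEDistIn W p q < ENNReal.ofReal (R + ε / 2) := by
        rw [ENNReal.ofReal_add hR.le (by positivity)]
        exact led_triangle hpx hxq
      obtain ⟨y, hy, hqy⟩ := hF₁ q hq hpq
      refine ⟨y, Finset.mem_union_left _ hy, ?_⟩
      rw [← hee]
      exact led_triangle hxq hqy
end
end

section
/- Let (M,d) be a geodesic metric space, Y⊆M a subset, δ>0, and let W = {z∈M : d(z,Y) ≤ δ/2} be the closed δ/2-neighborhood of Y, equipped with its induced length metric d_W. Then for all x,y∈Y: (i) d_Y^δ(x,y) ≥ d_W(x,y) ≥ d(x,y); and (ii) if d(x,y) ≤ δ, then d_Y^δ(x,y) = d(x,y). -/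
open Set Metric Filter MeasureTheory ENNReal NNReal

noncomputable section

/-- The `δ`-intrinsic (chain) extended distance on a subset `Y`: the infimum of the
total lengths of chains in `Y` from `x` to `y` with steps of ambient distance `≤ δ`. -/
def chainEDist {M : Type*} [MetricSpace M] (Y : Set M) (δ : ℝ) (x y : M) : ℝ≥0∞ :=
  ⨅ (n : ℕ) (u : ℕ → M) (_ : u 0 = x) (_ : u n = y) (_ : ∀ k ≤ n, u k ∈ Y)
    (_ : ∀ k < n, dist (u k) (u (k + 1)) ≤ δ),
    ∑ k ∈ Finset.range n, edist (u k) (u (k + 1))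

/-- A geodesic metric space: any two points are joined by a continuous path whose
length equals their distance. -/
def IsGeodesicSpace (M : Type*) [MetricSpace M] : Prop :=
  ∀ x y : M, ∃ γ : ℝ → M, ContinuousOn γ (Set.Icc 0 1) ∧ γ 0 = x ∧ γ 1 = y ∧
    eVariationOn γ (Set.Icc 0 1) = edist x y


def PathIn {M : Type} [MetricSpace M] (S : Set M) (x y : M) (l : ℝ≥0∞) : Prop :=
  ∃ γ : ℝ → M, ContinuousOn γ (Set.Icc 0 1) ∧ γ 0 = x ∧ γ 1 = y ∧
    Set.MapsTo γ (Set.Icc 0 1) S ∧ eVariationOn γ (Set.Icc 0 1) ≤ l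

theorem PathIn.concat {M : Type} [MetricSpace M] {S : Set M} {x y z : M} {l m : ℝ≥0∞}
    (h1 : PathIn S x y l) (h2 : PathIn S y z m) : PathIn S x z (l + m) := by
  obtain ⟨a, ac, a0, a1, aS, al⟩ := h1
  obtain ⟨b, bc, b0, b1, bS, bl⟩ := h2
  have ma : Set.MapsTo (fun t : ℝ => 2 * t) (Set.Icc 0 (1/2)) (Set.Icc 0 1) := by
    intro t ht
    simp only [Set.mem_Icc] at *
    constructor <;> linarith [ht.1, ht.2]
  have mb : Set.MapsTo (fun t : ℝ => 2 * t - 1) (Set.Icc (1/2) 1) (Set.Icc 0 1) := by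
    intro t ht
    simp only [Set.mem_Icc] at *
    constructor <;> linarith [ht.1, ht.2]
  let g : ℝ → M := fun t => if t ≤ 1/2 then a (2 * t) else b (2 * t - 1)
  have ga : Set.EqOn g (a ∘ fun t : ℝ => 2 * t) (Set.Icc 0 (1/2)) := by
    intro t ht
    simp only [g, if_pos ht.2, Function.comp]
  have gb : Set.EqOn g (b ∘ fun t : ℝ => 2 * t - 1) (Set.Icc (1/2) 1) := by
    intro t ht
    rcases eq_or_lt_of_le ht.1 with h | h
    · subst h
      simp [g, a1, b0]
    · simp only [g, if_neg (not_le.2 h), Function.comp]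
  have hU : Set.Icc (0:ℝ) 1 = Set.Icc 0 (1/2) ∪ Set.Icc (1/2) 1 :=
    (Set.Icc_union_Icc_eq_Icc (by norm_num) (by norm_num)).symm
  refine ⟨g, ?_, ?_, ?_, ?_, ?_⟩
  · rw [hU]
    refine ContinuousOn.union_of_isClosed ?_ ?_ isClosed_Icc isClosed_Icc
    · exact (ac.comp (by fun_prop) ma).congr ga
    · exact (bc.comp (by fun_prop) mb).congr gb
  · simp [g, a0]
  · have : ¬ (1:ℝ) ≤ 1/2 := by norm_num
    simp only [g, if_neg this]
    norm_num [b1]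
  · rw [hU]
    rintro t (ht | ht)
    · rw [ga ht]; exact aS (ma ht)
    · rw [gb ht]; exact bS (mb ht)
  · rw [hU, eVariationOn.union g (x := 1/2) (isGreatest_Icc (by norm_num))
      (isLeast_Icc (by norm_num)), eVariationOn.congr ga, eVariationOn.congr gb]
    refine add_le_add (le_trans ?_ al) (le_trans ?_ bl)
    · exact eVariationOn.comp_le_of_monotoneOn a (fun t : ℝ => 2 * t)
        (fun s _ t _ h => by dsimp only; linarith) ma
    · exact eVariationOn.comp_le_of_monotoneOn b (fun t : ℝ => 2 * t - 1)
        (fun s _ t _ h => by dsimp only; linarith) mb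

theorem PathIn.geod {M : Type} [MetricSpace M] (hM : IsGeodesicSpace M)
    {Y : Set M} {δ : ℝ} (hδ : 0 < δ) {x y : M} (hx : x ∈ Y) (hy : y ∈ Y)
    (h : dist x y ≤ δ) :
    PathIn {z : M | EMetric.infEdist z Y ≤ ENNReal.ofReal (δ / 2)} x y (edist x y) := by
  obtain ⟨γ, c, c0, c1, cv⟩ := hM x y
  refine ⟨γ, c, c0, c1, ?_, cv.le⟩
  intro t ht
  have hs : edist x (γ t) + edist (γ t) y ≤ edist x y := by
    rw [← cv, ← Set.Icc_union_Icc_eq_Icc ht.1 ht.2,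
      eVariationOn.union γ (isGreatest_Icc ht.1) (isLeast_Icc ht.2)]
    refine add_le_add ?_ ?_
    · rw [← c0]
      exact eVariationOn.edist_le γ (Set.left_mem_Icc.2 ht.1) (Set.right_mem_Icc.2 ht.1)
    · rw [← c1]
      exact eVariationOn.edist_le γ (Set.left_mem_Icc.2 ht.2) (Set.right_mem_Icc.2 ht.2)
  have hd : dist x (γ t) + dist (γ t) y ≤ dist x y := by
    rw [edist_dist, edist_dist, edist_dist, ← ENNReal.ofReal_add dist_nonneg dist_nonneg] at hs
    exact (ENNReal.ofReal_le_ofReal_iff dist_nonneg).1 hs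
  show EMetric.infEdist _ _ ≤ _
  rcases le_total (dist x (γ t)) (δ / 2) with h1 | h1
  · refine (Metric.infEDist_le_edist_of_mem hx).trans ?_
    rw [edist_comm, edist_dist]
    exact ENNReal.ofReal_le_ofReal h1
  · refine (Metric.infEDist_le_edist_of_mem hy).trans ?_
    rw [edist_dist]
    exact ENNReal.ofReal_le_ofReal (by linarith)

theorem PathIn.le {M : Type} [MetricSpace M] {S : Set M} {x y : M} {l : ℝ≥0∞}
    (h : PathIn S x y l) : lengthEDistIn S x y ≤ l := by
  obtain ⟨γ, c, c0, c1, cS, cv⟩ := h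
  unfold lengthEDistIn
  exact iInf_le_of_le γ <| iInf_le_of_le c <| iInf_le_of_le c0 <| iInf_le_of_le c1 <|
    iInf_le_of_le cS cv

theorem PathIn.chain {M : Type} [MetricSpace M] (hM : IsGeodesicSpace M)
    {Y : Set M} {δ : ℝ} (hδ : 0 < δ) (u : ℕ → M) (n : ℕ) (hu : ∀ k ≤ n, u k ∈ Y)
    (hd : ∀ k < n, dist (u k) (u (k + 1)) ≤ δ) :
    PathIn {z : M | EMetric.infEdist z Y ≤ ENNReal.ofReal (δ / 2)} (u 0) (u n)
      (∑ k ∈ Finset.range n, edist (u k) (u (k + 1))) := by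
  induction n with
  | zero =>
    have := PathIn.geod hM hδ (hu 0 le_rfl) (hu 0 le_rfl) (by simpa using hδ.le)
    simpa using this
  | succ n ih =>
    rw [Finset.sum_range_succ]
    exact (ih (fun k hk => hu k (by omega)) (fun k hk => hd k (by omega))).concat
      (PathIn.geod hM hδ (hu n (by omega)) (hu (n+1) le_rfl) (hd n (by omega)))

/-- Comparison of the `δ`-intrinsic metric of `Y` with the induced length metric of the
closed `δ/2`-neighborhood `W` of `Y` in a geodesic space: (i) `d_Y^δ ≥ d_W ≥ d`, and
(ii) `d_Y^δ` agrees with the ambient distance at scales `≤ δ`. -/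
theorem chainEDist_comparison {M : Type} [MetricSpace M] (hM : IsGeodesicSpace M)
    (Y : Set M) (δ : ℝ) (hδ : 0 < δ) :
    ∀ x ∈ Y, ∀ y ∈ Y,
      (lengthEDistIn {z : M | EMetric.infEdist z Y ≤ ENNReal.ofReal (δ / 2)} x y ≤
          chainEDist Y δ x y ∧
        edist x y ≤
          lengthEDistIn {z : M | EMetric.infEdist z Y ≤ ENNReal.ofReal (δ / 2)} x y) ∧
      (dist x y ≤ δ → chainEDist Y δ x y = edist x y) := by
  intro x hx y hy
  refine ⟨⟨?_, ?_⟩, fun h => le_antisymm ?_ ?_⟩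
  · refine le_iInf fun n => le_iInf fun u => le_iInf fun h0 => le_iInf fun h1 =>
      le_iInf fun hu => le_iInf fun hd => ?_
    have := (PathIn.chain hM hδ u n hu hd).le
    rwa [h0, h1] at this
  · refine le_iInf fun γ => le_iInf fun c => le_iInf fun h0 => le_iInf fun h1 =>
      le_iInf fun _ => ?_
    rw [← h0, ← h1]
    exact eVariationOn.edist_le γ (by simp) (by simp)
  · refine iInf_le_of_le 1 <| iInf_le_of_le (fun k => if k = 0 then x else y) <|
      iInf_le_of_le (by simp) <| iInf_le_of_le (by simp) <| iInf_le_of_le ?_ <|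
      iInf_le_of_le ?_ ?_
    · intro k _
      by_cases hk : k = 0 <;> simp [hk, hx, hy]
    · intro k hk
      obtain rfl : k = 0 := by omega
      simpa using h
    · simp
  · refine le_iInf fun n => le_iInf fun u => le_iInf fun h0 => le_iInf fun h1 =>
      le_iInf fun hu => le_iInf fun hd => ?_
    rw [← h0, ← h1]
    exact edist_le_range_sum_edist u n
end
end

section
/- Let W⊆ℝⁿ be an open connected set satisfying the (θ,H)-cone condition for some θ∈(0,π/2] and H>0. Then for every t>0 with t·(1+sinθ) ≤ H·sinθ and every x∈W, the point y = x + (t/sinθ)·v (where v is a unit vector with C(x,v,θ,H)⊆W) satisfies: the segment from x to y is contained in W, and the open Euclidean ball B_t(y) is contained in W. In particular, every point of W lies within intrinsic distance t/sinθ (with respect to the induced length metric d_W of W) of a point whose Euclidean distance to ℝⁿ∖W is at least t; that is, W is an undistorted domain of (1/sinθ)-Lipschitz type. -/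
open Set Metric Filter MeasureTheory ENNReal NNReal

noncomputable section

/-- The finite spherical cone with vertex `x`, axis direction `v`, angle `θ` and
length `H`. -/
def finiteCone {n : ℕ} (x v : EuclideanSpace ℝ (Fin n)) (θ H : ℝ) :
    Set (EuclideanSpace ℝ (Fin n)) :=
  {y | dist y x ≤ H ∧ (y = x ∨ InnerProductGeometry.angle (y - x) v ≤ θ)}

/-- `W` satisfies the `(θ, H)`-cone condition. -/
def ConeCondition {n : ℕ} (W : Set (EuclideanSpace ℝ (Fin n))) (θ H : ℝ) : Prop :=
  ∀ x ∈ W, ∃ v : EuclideanSpace ℝ (Fin n), ‖v‖ = 1 ∧ finiteCone x v θ H ⊆ W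

theorem ball_sub_cone_aux {n : ℕ} (x v z : EuclideanSpace ℝ (Fin n)) (θ H t : ℝ)
    (hθ₀ : 0 < θ) (hθ₁ : θ ≤ Real.pi / 2) (ht : 0 < t)
    (hH : t * (1 + Real.sin θ) ≤ H * Real.sin θ) (hv : ‖v‖ = 1)
    (hz : dist z (x + (t / Real.sin θ) • v) < t) : z ∈ finiteCone x v θ H := by
  have hs : 0 < Real.sin θ := Real.sin_pos_of_pos_of_lt_pi hθ₀ (by linarith [Real.pi_pos])
  have hs1 : Real.sin θ ≤ 1 := Real.sin_le_one θ
  have hcos : 0 ≤ Real.cos θ := Real.cos_nonneg_of_mem_Icc ⟨by linarith [Real.pi_pos], hθ₁⟩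
  have hsc := Real.sin_sq_add_cos_sq θ
  set s := Real.sin θ with hsdef
  set k := Real.cos θ with hkdef
  set c := t / s with hc
  have hct : c * s = t := by rw [hc]; field_simp
  have hc0 : 0 < c := div_pos ht hs
  set u := z - (x + c • v) with hu
  have hun : ‖u‖ < t := by rwa [hu, ← dist_eq_norm]
  have hw : z - x = c • v + u := by rw [hu]; abel
  have hcH : c + t ≤ H := by
    have : (c + t) * s ≤ H * s := by nlinarith
    exact le_of_mul_le_mul_right this hs
  refine ⟨?_, Or.inr ?_⟩
  · rw [dist_eq_norm, hw]
    calc ‖c • v + u‖ ≤ ‖c • v‖ + ‖u‖ := norm_add_le _ _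
      _ ≤ c + t := by
        rw [norm_smul, hv, Real.norm_of_nonneg hc0.le]; linarith
      _ ≤ H := hcH
  · set a := inner ℝ u v with ha
    have ha1 : |a| ≤ ‖u‖ := by
      have := abs_real_inner_le_norm u v
      rwa [hv, mul_one] at this
    have hp : inner ℝ (z - x) v = c + a := by
      rw [hw, inner_add_left, real_inner_smul_left, real_inner_self_eq_norm_sq, hv]; ring
    have hn : ‖z - x‖ ^ 2 = c ^ 2 + 2 * c * a + ‖u‖ ^ 2 := by
      rw [hw, norm_add_sq_real, norm_smul, hv, Real.norm_of_nonneg hc0.le, real_inner_smul_left,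
        real_inner_comm]
      ring
    have hp0 : 0 < c + a := by
      have := neg_abs_le a
      nlinarith
    have hu2 : ‖u‖ ^ 2 ≤ c ^ 2 * s ^ 2 := by
      rw [← mul_pow, hct]
      exact pow_le_pow_left₀ (norm_nonneg _) hun.le 2
    have hk2 : k ^ 2 = 1 - s ^ 2 := by linarith
    have key : ‖z - x‖ * k ≤ c + a := by
      apply le_of_sq_le_sq _ hp0.le
      rw [mul_pow, hn, hk2]
      have h1 : 0 ≤ 1 - s ^ 2 := by rw [← hk2]; positivity
      nlinarith [sq_nonneg (a + c * s ^ 2), mul_le_mul_of_nonneg_right hu2 h1]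
    have hz0 : 0 < ‖z - x‖ := by
      rw [norm_pos_iff]
      intro h
      rw [h, inner_zero_left] at hp
      linarith
    by_contra hlt
    push Not at hlt
    have h1 := Real.cos_lt_cos_of_nonneg_of_le_pi hθ₀.le
      (InnerProductGeometry.angle_le_pi (z - x) v) hlt
    have h2 := InnerProductGeometry.cos_angle_mul_norm_mul_norm (z - x) v
    rw [hv, mul_one, hp] at h2
    nlinarith

/-- Domains satisfying the `(θ, H)`-cone condition are undistorted of
`(1/sin θ)`-Lipschitz type: for suitable `t`, moving distance `t / sin θ` along the cone
axis from any `x ∈ W` stays in `W` and reaches a point `y` with `B_t(y) ⊆ W`; in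
particular every point of `W` is within intrinsic distance `t / sin θ` of a point whose
Euclidean distance to the complement of `W` is at least `t`. -/
theorem cone_condition_lipschitz_type {n : ℕ} (W : Set (EuclideanSpace ℝ (Fin n)))
    (hW_open : IsOpen W) (hW_conn : IsConnected W) (θ H : ℝ)
    (hθ₀ : 0 < θ) (hθ₁ : θ ≤ Real.pi / 2) (hH : 0 < H)
    (hcone : ConeCondition W θ H) :
    ∀ t : ℝ, 0 < t → t * (1 + Real.sin θ) ≤ H * Real.sin θ →
      (∀ x ∈ W, ∀ v : EuclideanSpace ℝ (Fin n), ‖v‖ = 1 → finiteCone x v θ H ⊆ W →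
        segment ℝ x (x + (t / Real.sin θ) • v) ⊆ W ∧
        Metric.ball (x + (t / Real.sin θ) • v) t ⊆ W) ∧
      ∀ x ∈ W, ∃ y ∈ W, lengthEDistIn W x y ≤ ENNReal.ofReal (t / Real.sin θ) ∧
        ∀ z, z ∉ W → t ≤ dist y z := by
  intro t ht htH
  have hs : 0 < Real.sin θ := Real.sin_pos_of_pos_of_lt_pi hθ₀ (by linarith [Real.pi_pos])
  have hc0 : 0 < t / Real.sin θ := div_pos ht hs
  have hcH : t / Real.sin θ ≤ H := by
    rw [div_le_iff₀ hs]; nlinarith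
  have main : ∀ x ∈ W, ∀ v : EuclideanSpace ℝ (Fin n), ‖v‖ = 1 → finiteCone x v θ H ⊆ W →
        segment ℝ x (x + (t / Real.sin θ) • v) ⊆ W ∧
        Metric.ball (x + (t / Real.sin θ) • v) t ⊆ W := by
    intro x hx v hv hC
    refine ⟨?_, fun z hz => hC (ball_sub_cone_aux x v z θ H t hθ₀ hθ₁ ht htH hv hz)⟩
    rw [segment_eq_image']
    rintro _ ⟨r, ⟨hr0, hr1⟩, rfl⟩
    apply hC
    simp only [add_sub_cancel_left, smul_smul]
    refine ⟨?_, ?_⟩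
    · rw [dist_eq_norm, add_sub_cancel_left, norm_smul, hv, mul_one,
        Real.norm_of_nonneg (by positivity)]
      nlinarith
    · rcases hr0.eq_or_lt with h | h
      · left; simp [← h]
      · right
        rw [add_sub_cancel_left, InnerProductGeometry.angle_smul_left_of_pos _ _ (by positivity),
          InnerProductGeometry.angle_self (by intro h0; simp [h0] at hv)]
        exact hθ₀.le
  refine ⟨main, fun x hx => ?_⟩
  obtain ⟨v, hv, hC⟩ := hcone x hx
  obtain ⟨hseg, hball⟩ := main x hx v hv hC
  refine ⟨x + (t / Real.sin θ) • v, hball (Metric.mem_ball_self ht), ?_, ?_⟩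
  · set c := t / Real.sin θ with hc
    have hL : LipschitzWith (Real.toNNReal c) (fun r : ℝ => x + r • (c • v)) := by
      apply LipschitzWith.of_dist_le_mul
      intro p q
      rw [dist_add_left, dist_eq_norm, ← sub_smul, norm_smul, norm_smul, hv,
        Real.norm_of_nonneg hc0.le, Real.coe_toNNReal _ hc0.le, ← dist_eq_norm]
      linarith
    unfold lengthEDistIn
    refine (iInf₂_le (fun r : ℝ => x + r • (c • v)) hL.continuous.continuousOn).trans ?_
    refine (iInf₂_le (by simp) (by simp)).trans ?_
    refine (iInf_le _ ?_).trans ?_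
    · intro r hr
      apply hseg
      rw [segment_eq_image']
      exact ⟨r, hr, by simp⟩
    · have h1 := (hL.lipschitzOnWith (s := Set.univ)).comp_eVariationOn_le
        (g := (id : ℝ → ℝ)) (s := Set.Icc (0:ℝ) 1) (fun _ _ => Set.mem_univ _)
      have h2 := (monotone_id.monotoneOn (Set.Icc (0:ℝ) 1)).eVariationOn_le
        (a := 0) (b := 1) (by simp) (by simp)
      rw [Set.inter_self] at h2
      simp only [id, sub_zero, ENNReal.ofReal_one] at h2
      refine h1.trans ?_
      calc _ ≤ (Real.toNNReal c : ℝ≥0∞) * 1 := by gcongr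
        _ = ENNReal.ofReal c := by rw [mul_one]; rfl
  · intro z hz
    by_contra hlt
    push Not at hlt
    exact hz (hball (by rwa [Metric.mem_ball, dist_comm]))
end
end
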